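/- arXiv:0910.0641 — 5 statements merged into one kernel-verified Lean document; each statement's English description precedes it below -/
import Mathlib

section
/- Let f : F₂ⁿ → F₂ and let A₁, …, A_K be distinct hyperplanes of F₂ⁿ such that for each i there is a function P_i of degree at most d with Pr_{x uniform in A_i}[f(x) ≠ P_i(x)] ≤ α. If K > 2^{d+1} and α < 2^{−(d+2)}, then δ_d(f) ≤ (3/2)·α + 9/K. -/
open scoped Classical

noncomputable section

/-- `f : 𝔽₂ⁿ → 𝔽₂` has degree at most `d` (as a multilinear polynomial). -/
def degLE (n d : ℕ) (f : (Fin n → ZMod 2) → ZMod 2) : Prop :=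
  ∃ p : MvPolynomial (Fin n) (ZMod 2), p.totalDegree ≤ d ∧ ∀ x, MvPolynomial.eval x p = f x

/-- fractional Hamming distance between two functions on 𝔽₂ⁿ. -/
def hdist (n : ℕ) (f g : (Fin n → ZMod 2) → ZMod 2) : ℝ :=
  ((Finset.univ.filter fun x => f x ≠ g x).card : ℝ) / 2 ^ n

/-- distance of `f` to the Reed–Muller code RM(d,n). -/
def deltaD (n d : ℕ) (f : (Fin n → ZMod 2) → ZMod 2) : ℝ :=
  sInf {r : ℝ | ∃ g, degLE n d g ∧ r = hdist n f g}

/-- Rejection probability of the `k`-flat test: a uniformly random `k`-flat is chosen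
(via a uniformly random injective affine parametrization `u ↦ M u + b`), and the test
rejects iff the restriction of `f` does not have degree at most `d`. -/
def Rej (n d k : ℕ) (f : (Fin n → ZMod 2) → ZMod 2) : ℝ :=
  ((Finset.univ.filter fun Mb : Matrix (Fin n) (Fin k) (ZMod 2) × (Fin n → ZMod 2) =>
      Function.Injective Mb.1.mulVec ∧
        ¬ degLE k d (fun u => f (Mb.1.mulVec u + Mb.2))).card : ℝ) /
  ((Finset.univ.filter fun Mb : Matrix (Fin n) (Fin k) (ZMod 2) × (Fin n → ZMod 2) =>
      Function.Injective Mb.1.mulVec).card : ℝ)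

/-- Rejection probability of the (d+1)-fold derivative (Gowers norm) test. -/
def Rej0 (n d : ℕ) (f : (Fin n → ZMod 2) → ZMod 2) : ℝ :=
  ((Finset.univ.filter fun xa : (Fin n → ZMod 2) × (Fin (d+1) → Fin n → ZMod 2) =>
      (∑ S : Finset (Fin (d+1)), f (xa.1 + ∑ i ∈ S, xa.2 i)) = 1).card : ℝ) /
  ((2 ^ n) * (2 ^ n) ^ (d+1) : ℝ)

/-- the (d+1)-st Gowers norm of `f`. -/
def gowersNorm (n d : ℕ) (f : (Fin n → ZMod 2) → ZMod 2) : ℝ :=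
  (1 - 2 * Rej0 n d f) ^ ((1 : ℝ) / 2 ^ (d+1))

/-- t-fold XOR of `f`, as a function on 𝔽₂^(t·n). -/
def xorPow (n t : ℕ) (f : (Fin n → ZMod 2) → ZMod 2) :
    (Fin (t * n) → ZMod 2) → ZMod 2 :=
  fun x => ∑ i : Fin t, f fun j => x (finProdFinEquiv (i, j))

/-- elementary symmetric polynomial of degree m on n variables over 𝔽₂. -/
def symPoly (n m : ℕ) : (Fin n → ZMod 2) → ZMod 2 :=
  fun x => ∑ I ∈ Finset.powersetCard m Finset.univ, ∏ i ∈ I, x i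

/-- the hyperplane `{x : L·x = b}`. -/
def hyp (n : ℕ) (L : Fin n → ZMod 2) (b : ZMod 2) : Set (Fin n → ZMod 2) :=
  {x | ∑ i, L i * x i = b}


section

variable {n d e : ℕ}

theorem zmod_two_eq_one_of_ne_zero {u : ZMod 2} (hu : u ≠ 0) : u = 1 := by
  revert u
  decide

theorem degLE.mono {f : (Fin n → ZMod 2) → ZMod 2} (hf : degLE n d f) (h : d ≤ e) :
    degLE n e f := by
  obtain ⟨p, hp, hpf⟩ := hf
  exact ⟨p, hp.trans h, hpf⟩

theorem degLE_const (c : ZMod 2) : degLE n d fun _ => c :=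
  ⟨MvPolynomial.C c, by simp, by simp⟩

theorem degLE_coord (i : Fin n) : degLE n 1 fun x => x i :=
  ⟨MvPolynomial.X i, by simp, by simp⟩

theorem degLE.add {f g : (Fin n → ZMod 2) → ZMod 2} (hf : degLE n d f) (hg : degLE n d g) :
    degLE n d fun x => f x + g x := by
  obtain ⟨p, hp, hpf⟩ := hf
  obtain ⟨q, hq, hqg⟩ := hg
  exact ⟨p + q, (MvPolynomial.totalDegree_add _ _).trans (max_le hp hq), by simp [hpf, hqg]⟩

theorem degLE.mul {f g : (Fin n → ZMod 2) → ZMod 2} (hf : degLE n d f) (hg : degLE n e g) :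
    degLE n (d + e) fun x => f x * g x := by
  obtain ⟨p, hp, hpf⟩ := hf
  obtain ⟨q, hq, hqg⟩ := hg
  exact ⟨p * q, (MvPolynomial.totalDegree_mul _ _).trans (add_le_add hp hq), by simp [hpf, hqg]⟩

theorem degLE.sub {f g : (Fin n → ZMod 2) → ZMod 2} (hf : degLE n d f) (hg : degLE n d g) :
    degLE n d fun x => f x - g x := by
  simpa only [CharTwo.sub_eq_add] using hf.add hg

theorem degLE_dotProduct (L : Fin n → ZMod 2) : degLE n 1 fun x => L ⬝ᵥ x := by
  refine ⟨∑ i, MvPolynomial.C (L i) * MvPolynomial.X i,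
    MvPolynomial.totalDegree_finsetSum_le fun i _ => ?_, fun x => by simp [dotProduct]⟩
  exact (MvPolynomial.totalDegree_mul _ _).trans (by simp)

/-- Functions of degree at most `d` are the sums of monomials with at most `d` factors. -/
theorem degLE.induction {C : ((Fin n → ZMod 2) → ZMod 2) → Prop}
    (zero : C fun _ => 0) (add : ∀ f g, C f → C g → C fun x => f x + g x)
    (monomial : ∀ s : Multiset (Fin n), Multiset.card s ≤ d → C fun x => (s.map x).prod)
    {f : (Fin n → ZMod 2) → ZMod 2} (hf : degLE n d f) : C f := by
  obtain ⟨p, hp, hpf⟩ := hf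
  have hterm : ∀ m ∈ p.support, C fun x => p.coeff m * ∏ i ∈ m.support, x i ^ m i := by
    intro m hm
    have hone : p.coeff m = 1 := zmod_two_eq_one_of_ne_zero (MvPolynomial.mem_support_iff.mp hm)
    have hcard : Multiset.card m.toMultiset ≤ d := by
      rw [Finsupp.card_toMultiset]
      exact (MvPolynomial.le_totalDegree hm).trans hp
    have hprod : (fun x : Fin n → ZMod 2 => p.coeff m * ∏ i ∈ m.support, x i ^ m i) =
        fun x => (m.toMultiset.map x).prod := by
      funext x
      rw [hone, one_mul, Finsupp.toMultiset_map, Finsupp.prod_toMultiset,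
        Finsupp.prod_mapDomain_index (by simp) (by simp [pow_add])]
      rfl
    rw [hprod]
    exact monomial _ hcard
  have hsum : ∀ s : Finset (Fin n →₀ ℕ), s ⊆ p.support →
      C fun x => ∑ m ∈ s, p.coeff m * ∏ i ∈ m.support, x i ^ m i := by
    intro s
    induction s using Finset.induction_on with
    | empty => intro _; simpa using zero
    | insert m s hms ih =>
      intro hs
      simp only [Finset.sum_insert hms]
      exact add _ _ (hterm m (hs (Finset.mem_insert_self _ _)))
        (ih ((Finset.subset_insert _ _).trans hs))
  have hf : f = fun x => ∑ m ∈ p.support, p.coeff m * ∏ i ∈ m.support, x i ^ m i := by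
    funext x
    rw [← hpf, MvPolynomial.eval_eq]
  rw [hf]
  exact hsum _ subset_rfl

theorem degLE_multiset_prod {h : (Fin n → ZMod 2) → Fin n → ZMod 2}
    (hh : ∀ i, degLE n 1 fun x => h x i) (s : Multiset (Fin n)) :
    degLE n (Multiset.card s) fun x => (s.map (h x)).prod := by
  induction s using Multiset.induction_on with
  | empty => simpa using degLE_const 1
  | cons i s ih =>
    simp only [Multiset.map_cons, Multiset.prod_cons, Multiset.card_cons]
    exact ((hh i).mul ih).mono (by omega)

theorem degLE.comp {f : (Fin n → ZMod 2) → ZMod 2} (hf : degLE n d f)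
    {h : (Fin n → ZMod 2) → Fin n → ZMod 2} (hh : ∀ i, degLE n 1 fun x => h x i) :
    degLE n d fun x => f (h x) :=
  degLE.induction (C := fun f => degLE n d fun x => f (h x)) (degLE_const 0)
    (fun _ _ => degLE.add) (fun s hs => (degLE_multiset_prod hh s).mono hs) hf

theorem degLE_derivative_monomial (a : Fin n → ZMod 2) (s : Multiset (Fin n)) :
    degLE n (Multiset.card s - 1) fun x => (s.map (x + a)).prod - (s.map x).prod := by
  induction s using Multiset.induction_on with
  | empty => simpa using degLE_const 0
  | cons i s ih =>
    have hshift : degLE n (Multiset.card s) fun x => (s.map (x + a)).prod :=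
      degLE_multiset_prod (h := fun x => x + a)
        (fun i => (degLE_coord i).add (degLE_const (a i))) s
    have hsplit : (fun x : Fin n → ZMod 2 =>
        ((i ::ₘ s).map (x + a)).prod - ((i ::ₘ s).map x).prod) =
        fun x => x i * ((s.map (x + a)).prod - (s.map x).prod) + a i * (s.map (x + a)).prod := by
      funext x
      simp only [Multiset.map_cons, Multiset.prod_cons, Pi.add_apply]
      ring
    rw [hsplit]
    refine degLE.add ?_ (((degLE_const (d := 0) (a i)).mul hshift).mono (by simp))
    rcases Multiset.empty_or_exists_mem s with rfl | ⟨j, hj⟩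
    · simpa using degLE_const 0
    · have hpos := Multiset.card_pos_iff_exists_mem.mpr ⟨j, hj⟩
      exact ((degLE_coord i).mul ih).mono (by rw [Multiset.card_cons]; omega)

theorem degLE.derivative {f : (Fin n → ZMod 2) → ZMod 2} (hf : degLE n d f)
    (a : Fin n → ZMod 2) : degLE n (d - 1) fun x => f (x + a) - f x := by
  refine degLE.induction (C := fun f => degLE n (d - 1) fun x => f (x + a) - f x) ?_ ?_ ?_ hf
  · simpa using degLE_const 0
  · intro f g hf hg
    convert hf.add hg using 2
    ring
  · exact fun s hs => (degLE_derivative_monomial a s).mono (by omega)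

theorem degLE.eq_of_zero {f : (Fin n → ZMod 2) → ZMod 2} (hf : degLE n 0 f)
    (x y : Fin n → ZMod 2) : f x = f y := by
  obtain ⟨p, hp, hpf⟩ := hf
  rw [← hpf, ← hpf, MvPolynomial.totalDegree_eq_zero_iff_eq_C.mp (Nat.le_zero.mp hp)]
  simp

/-- The minimum distance of the Reed–Muller code. -/
theorem degLE.two_pow_le_card_ne_zero {f : (Fin n → ZMod 2) → ZMod 2} (hf : degLE n d f)
    (hne : ∃ x, f x ≠ 0) :
    2 ^ n ≤ 2 ^ d * (Finset.univ.filter fun x => f x ≠ 0).card := by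
  induction d generalizing f with
  | zero =>
    obtain ⟨x₀, hx₀⟩ := hne
    have huniv : (Finset.univ.filter fun x => f x ≠ 0) = Finset.univ :=
      Finset.filter_true_of_mem fun x _ => hf.eq_of_zero x x₀ ▸ hx₀
    rw [huniv]
    simp [ZMod.card]
  | succ d ih =>
    by_cases hder : ∃ a x, f (x + a) - f x ≠ 0
    · obtain ⟨a, hx⟩ := hder
      have hsub : (Finset.univ.filter fun x => f (x + a) - f x ≠ 0) ⊆
          (Finset.univ.filter fun x => f x ≠ 0).image (fun x => x - a) ∪
            Finset.univ.filter fun x => f x ≠ 0 := by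
        intro x hx
        simp only [Finset.mem_union, Finset.mem_image, Finset.mem_filter, Finset.mem_univ,
          true_and] at hx ⊢
        by_cases h : f x = 0
        · exact Or.inl ⟨x + a, by simpa [h] using hx, by simp⟩
        · exact Or.inr h
      have hcard := (Finset.card_le_card hsub).trans (Finset.card_union_le _ _)
      have himage := Finset.card_image_le (s := Finset.univ.filter fun x => f x ≠ 0)
        (f := fun x => x - a)
      calc 2 ^ n ≤ 2 ^ d * _ := ih (hf.derivative a) hx
        _ ≤ 2 ^ d * (2 * (Finset.univ.filter fun x => f x ≠ 0).card) :=
            Nat.mul_le_mul_left _ (by omega)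
        _ = _ := by ring
    · push Not at hder
      obtain ⟨x₀, hx₀⟩ := hne
      have hconst : f = fun _ => f x₀ := by
        funext x
        simpa [sub_eq_zero] using hder (x - x₀) x₀
      have hzero : degLE n d f := hconst ▸ degLE_const _
      refine (ih hzero ⟨x₀, hx₀⟩).trans (Nat.mul_le_mul_right _ ?_)
      exact Nat.pow_le_pow_right two_pos d.le_succ

/-- The indicator function of a hyperplane, as a function of degree `1`. -/
theorem degLE_indicator (L : Fin n → ZMod 2) (b : ZMod 2) :
    degLE n 1 fun x => L ⬝ᵥ x + (b + 1) :=
  (degLE_dotProduct L).add (degLE_const _)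

theorem indicator_ne_zero_iff (u b : ZMod 2) : u + (b + 1) ≠ 0 ↔ u = b := by
  revert u b
  decide

theorem eq_on_hyp {P Q : (Fin n → ZMod 2) → ZMod 2} (hP : degLE n d P) (hQ : degLE n d Q)
    {L : Fin n → ZMod 2} {b : ZMod 2}
    (hcard : 2 ^ (d + 1) *
      (Finset.univ.filter fun x => x ∈ hyp n L b ∧ P x ≠ Q x).card < 2 ^ n)
    {x : Fin n → ZMod 2} (hx : x ∈ hyp n L b) : P x = Q x := by
  by_contra hne
  have key := ((hP.sub hQ).mul (degLE_indicator L b)).two_pow_le_card_ne_zero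
    ⟨x, mul_ne_zero (sub_ne_zero.mpr hne) ((indicator_ne_zero_iff _ _).mpr hx)⟩
  refine absurd key (not_le.mpr ?_)
  convert hcard using 3
  congr 1
  ext y
  simp only [Finset.mem_filter, Finset.mem_univ, true_and, mul_ne_zero_iff, sub_ne_zero,
    indicator_ne_zero_iff]
  exact and_comm

theorem eq_on_hyp_inter {P Q : (Fin n → ZMod 2) → ZMod 2} (hP : degLE n d P)
    (hQ : degLE n d Q) {L M : Fin n → ZMod 2} {b c : ZMod 2}
    (hcard : 2 ^ (d + 2) * (Finset.univ.filter fun x =>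
      x ∈ hyp n L b ∧ x ∈ hyp n M c ∧ P x ≠ Q x).card < 2 ^ n)
    {x : Fin n → ZMod 2} (hxL : x ∈ hyp n L b) (hxM : x ∈ hyp n M c) : P x = Q x := by
  by_contra hne
  have key := (((hP.sub hQ).mul (degLE_indicator L b)).mul
    (degLE_indicator M c)).two_pow_le_card_ne_zero
    ⟨x, mul_ne_zero (mul_ne_zero (sub_ne_zero.mpr hne) ((indicator_ne_zero_iff _ _).mpr hxL))
      ((indicator_ne_zero_iff _ _).mpr hxM)⟩
  refine absurd key (not_le.mpr ?_)
  convert hcard using 3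
  congr 1
  ext y
  simp only [Finset.mem_filter, Finset.mem_univ, true_and, mul_ne_zero_iff, sub_ne_zero,
    indicator_ne_zero_iff]
  constructor
  · exact fun h => ⟨h.1.2, h.2, h.1.1⟩
  · exact fun h => ⟨⟨h.2.2, h.1⟩, h.2.1⟩

/-- Polynomials that agree on the pairwise intersections of independent hyperplanes glue. -/
theorem exists_degLE_glue {κ : Type*} (L : κ → Fin n → ZMod 2) (b : κ → ZMod 2)
    (P : κ → (Fin n → ZMod 2) → ZMod 2) (hP : ∀ i, degLE n d (P i))
    (v : κ → Fin n → ZMod 2) (hv : ∀ i j, L i ⬝ᵥ v j = if i = j then 1 else 0)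
    (hagree : ∀ i j x, x ∈ hyp n (L i) (b i) → x ∈ hyp n (L j) (b j) → P i x = P j x)
    (s : Finset κ) :
    ∃ Q, degLE n d Q ∧ ∀ i ∈ s, ∀ x ∈ hyp n (L i) (b i), Q x = P i x := by
  induction s using Finset.induction_on with
  | empty => exact ⟨fun _ => 0, degLE_const 0, by simp⟩
  | insert k s hks ih =>
    obtain ⟨Q, hQ, hQP⟩ := ih
    let π : (Fin n → ZMod 2) → Fin n → ZMod 2 := fun x => x + (L k ⬝ᵥ x + b k) • v k
    have hπ : ∀ i, degLE n 1 fun x => π x i := fun i =>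
      (degLE_coord i).add
        (((degLE_dotProduct (L k)).add (degLE_const (b k))).mul (degLE_const (d := 0) (v k i)))
    have hπk : ∀ x, π x ∈ hyp n (L k) (b k) := by
      intro x
      change L k ⬝ᵥ (x + (L k ⬝ᵥ x + b k) • v k) = b k
      rw [dotProduct_add, dotProduct_smul, hv, if_pos rfl, smul_eq_mul, mul_one, ← add_assoc,
        CharTwo.add_self_eq_zero, zero_add]
    refine ⟨fun x => Q x + (P k (π x) - Q (π x)), hQ.add (((hP k).comp hπ).sub (hQ.comp hπ)), ?_⟩
    intro i hi x hx
    rcases Finset.mem_insert.mp hi with rfl | hi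
    · have hfix : π x = x := by
        change x + (L i ⬝ᵥ x + b i) • v i = x
        rw [show L i ⬝ᵥ x = b i from hx, CharTwo.add_self_eq_zero, zero_smul, add_zero]
      simp [hfix]
    · have hπi : π x ∈ hyp n (L i) (b i) := by
        change L i ⬝ᵥ (x + (L k ⬝ᵥ x + b k) • v k) = b i
        rw [dotProduct_add, dotProduct_smul, hv, if_neg (ne_of_mem_of_not_mem hi hks), smul_zero,
          add_zero]
        exact hx
      change Q x + (P k (π x) - Q (π x)) = P i x
      rw [hQP i hi _ hπi, hagree k i _ (hπk x) hπi, sub_self, add_zero, hQP i hi x hx]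

theorem exists_dual_vectors {κ : Type*} [Fintype κ] {L : κ → Fin n → ZMod 2}
    (hL : LinearIndependent (ZMod 2) L) :
    ∃ v : κ → Fin n → ZMod 2, ∀ i j, L i ⬝ᵥ v j = if i = j then 1 else 0 := by
  have hrank : (Matrix.of L).rank = Fintype.card κ := LinearIndependent.rank_matrix hL
  have hsurj : Function.Surjective (Matrix.of L).mulVecLin := by
    rw [← LinearMap.range_eq_top]
    apply Submodule.eq_top_of_finrank_eq
    rw [Module.finrank_fintype_fun_eq_card]
    exact hrank
  choose v hv using fun j => hsurj (Pi.single j 1)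
  refine ⟨v, fun i j => ?_⟩
  have h := congrFun (hv j) i
  rw [Pi.single_apply] at h
  exact h

theorem two_pow_mul_card_uncovered_le {κ : Type*} [Fintype κ] (L : κ → Fin n → ZMod 2)
    (b : κ → ZMod 2) (v : κ → Fin n → ZMod 2)
    (hv : ∀ i j, L i ⬝ᵥ v j = if i = j then 1 else 0) :
    2 ^ Fintype.card κ *
      (Finset.univ.filter fun x => ∀ i, x ∉ hyp n (L i) (b i)).card ≤ 2 ^ n := by
  let φ : (κ → ZMod 2) × (Fin n → ZMod 2) → Fin n → ZMod 2 := fun p => p.2 + ∑ j, p.1 j • v j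
  have hφ : ∀ p i, L i ⬝ᵥ φ p = L i ⬝ᵥ p.2 + p.1 i := by
    intro p i
    simp [φ, dotProduct_add, dotProduct_sum, hv]
  have hinj : Set.InjOn φ ((Finset.univ ×ˢ
      Finset.univ.filter fun x => ∀ i, x ∉ hyp n (L i) (b i) :
        Finset ((κ → ZMod 2) × (Fin n → ZMod 2)))) := by
    rintro ⟨c, x⟩ hx ⟨c', x'⟩ hx' h
    simp only [Finset.coe_product, Finset.coe_univ, Finset.coe_filter, Finset.mem_univ, true_and,
      Set.mem_prod, Set.mem_univ, Set.mem_ofPred_eq] at hx hx'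
    have hc : c = c' := by
      funext i
      have hi := congrArg (L i ⬝ᵥ ·) h
      simp only [hφ] at hi
      have hxi : L i ⬝ᵥ x ≠ b i := hx i
      have hxi' : L i ⬝ᵥ x' ≠ b i := hx' i
      revert hi hxi hxi'
      generalize L i ⬝ᵥ x = u
      generalize L i ⬝ᵥ x' = u'
      generalize b i = w
      generalize c i = y
      generalize c' i = y'
      revert u u' w y y'
      decide
    subst hc
    exact Prod.ext rfl (add_right_cancel h)
  have hcard := Finset.card_le_card_of_injOn φ (fun _ _ => Finset.mem_univ _) hinj
  simpa [Finset.card_product, ZMod.card] using hcard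

/-- The nontrivial additive character of `𝔽₂`. -/
def signChar (u : ZMod 2) : ℝ := if u = 0 then 1 else -1

theorem signChar_add (u w : ZMod 2) : signChar (u + w) = signChar u * signChar w := by
  have h : ∀ u : ZMod 2, u = 0 ∨ u = 1 := by decide
  have h2 : (1 + 1 : ZMod 2) = 0 := by decide
  rcases h u with rfl | rfl <;> rcases h w with rfl | rfl <;> simp [signChar, h2]

theorem sum_signChar_eq_zero {L : Fin n → ZMod 2} (hL : L ≠ 0) (b : ZMod 2) :
    ∑ x, signChar (L ⬝ᵥ x + b) = 0 := by
  obtain ⟨i, hi⟩ := Function.ne_iff.mp hL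
  have hone : L i = 1 := zmod_two_eq_one_of_ne_zero hi
  have hshift := Equiv.sum_comp (Equiv.addRight (Pi.single i (1 : ZMod 2)))
    fun x => signChar (L ⬝ᵥ x + b)
  have hneg : ∀ x : Fin n → ZMod 2,
      signChar (L ⬝ᵥ (x + Pi.single i 1) + b) = -signChar (L ⬝ᵥ x + b) := by
    intro x
    rw [dotProduct_add, dotProduct_single_one, hone, add_right_comm, signChar_add _ 1]
    simp [signChar]
  simp only [Equiv.coe_addRight, hneg, Finset.sum_neg_distrib] at hshift
  linarith

/-- Second moment bound: the hyperplanes are pairwise independent or disjoint. -/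
theorem sum_sq_sum_signChar_le {K : ℕ} (L : Fin K → Fin n → ZMod 2) (b : Fin K → ZMod 2)
    (hdistinct : Function.Injective fun i => (L i, b i)) :
    ∑ x, (∑ i, signChar (L i ⬝ᵥ x + b i)) ^ 2 ≤ K * 2 ^ n := by
  have hpair : ∀ i j, ∑ x, signChar (L i ⬝ᵥ x + b i) * signChar (L j ⬝ᵥ x + b j) ≤
      if i = j then (2 : ℝ) ^ n else 0 := by
    intro i j
    have hmul : ∀ x, signChar (L i ⬝ᵥ x + b i) * signChar (L j ⬝ᵥ x + b j) =
        signChar ((L i + L j) ⬝ᵥ x + (b i + b j)) := by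
      intro x
      rw [← signChar_add, add_dotProduct, add_add_add_comm]
    simp only [hmul]
    by_cases hij : i = j
    · subst hij
      simp [CharTwo.add_self_eq_zero, signChar, ZMod.card]
    · rw [if_neg hij]
      by_cases hLij : L i + L j = 0
      · have hb : b i + b j ≠ 0 := fun hb => hij (hdistinct (Prod.ext
          (funext fun k => CharTwo.add_eq_zero.mp (congrFun hLij k)) (CharTwo.add_eq_zero.mp hb)))
        simp [hLij, signChar, hb]
      · exact (sum_signChar_eq_zero hLij _).le
  calc ∑ x, (∑ i, signChar (L i ⬝ᵥ x + b i)) ^ 2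
      = ∑ i, ∑ j, ∑ x, signChar (L i ⬝ᵥ x + b i) * signChar (L j ⬝ᵥ x + b j) := by
        simp only [sq, Finset.sum_mul_sum]
        rw [Finset.sum_comm]
        exact Finset.sum_congr rfl fun i _ => Finset.sum_comm
    _ ≤ ∑ i : Fin K, ∑ j, if i = j then (2 : ℝ) ^ n else 0 :=
        Finset.sum_le_sum fun i _ => Finset.sum_le_sum fun j _ => hpair i j
    _ = K * 2 ^ n := by simp

/-- A function that is small on each of many hyperplanes is small. -/
theorem card_le_of_card_hyp_le {K : ℕ} (hK : 0 < K) (L : Fin K → Fin n → ZMod 2)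
    (b : Fin K → ZMod 2) (hdistinct : Function.Injective fun i => (L i, b i))
    (B : Finset (Fin n → ZMod 2)) (β : ℝ)
    (hB : ∀ i, ((B.filter fun x => x ∈ hyp n (L i) (b i)).card : ℝ) ≤ β) :
    (B.card : ℝ) ≤ 3 * β + 9 / K * 2 ^ n := by
  have hKpos : (0 : ℝ) < K := Nat.cast_pos.mpr hK
  let S : (Fin n → ZMod 2) → ℝ := fun x => ∑ i, signChar (L i ⬝ᵥ x + b i)
  have hcount : ∀ x, ∑ i, (if x ∈ hyp n (L i) (b i) then (1 : ℝ) else 0) = (K + S x) / 2 := by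
    intro x
    have hterm : ∀ i, (if x ∈ hyp n (L i) (b i) then (1 : ℝ) else 0) =
        (1 + signChar (L i ⬝ᵥ x + b i)) / 2 := by
      intro i
      have hiff : x ∈ hyp n (L i) (b i) ↔ L i ⬝ᵥ x + b i = 0 := CharTwo.add_eq_zero.symm
      unfold signChar
      by_cases h : L i ⬝ᵥ x + b i = 0 <;> simp [hiff, h]
    simp only [hterm, ← Finset.sum_div, Finset.sum_add_distrib]
    simp [S]
  have hrare : ∀ x, 1 ≤ 3 / K * ((K + S x) / 2) + 9 / K ^ 2 * S x ^ 2 := by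
    intro x
    have heq : 3 / K * ((K + S x) / 2) + 9 / K ^ 2 * S x ^ 2 - 1 =
        (K ^ 2 + 3 * K * S x + 18 * S x ^ 2) / (2 * (K : ℝ) ^ 2) := by
      field_simp
      ring
    have hnonneg : 0 ≤ (K ^ 2 + 3 * K * S x + 18 * S x ^ 2) / (2 * (K : ℝ) ^ 2) :=
      div_nonneg (by nlinarith [sq_nonneg (2 * K + 3 * S x), sq_nonneg (S x)]) (by positivity)
    linarith
  have hdouble : ∑ x ∈ B, (K + S x) / 2 ≤ K * β := by
    simp only [← hcount]
    rw [Finset.sum_comm]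
    calc _ ≤ ∑ _i : Fin K, β := Finset.sum_le_sum fun i _ => by
            rw [Finset.sum_boole]
            exact hB i
      _ = K * β := by simp
  have hmoment : ∑ x ∈ B, S x ^ 2 ≤ K * 2 ^ n :=
    (Finset.sum_le_sum_of_subset_of_nonneg (Finset.subset_univ B)
      fun x _ _ => sq_nonneg _).trans (sum_sq_sum_signChar_le L b hdistinct)
  calc (B.card : ℝ) = ∑ x ∈ B, 1 := by simp
    _ ≤ ∑ x ∈ B, (3 / K * ((K + S x) / 2) + 9 / K ^ 2 * S x ^ 2) :=
        Finset.sum_le_sum fun x _ => hrare x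
    _ = 3 / K * ∑ x ∈ B, (K + S x) / 2 + 9 / K ^ 2 * ∑ x ∈ B, S x ^ 2 := by
        rw [Finset.sum_add_distrib, Finset.mul_sum, Finset.mul_sum]
    _ ≤ 3 / K * (K * β) + 9 / K ^ 2 * (K * 2 ^ n) := by gcongr
    _ = 3 * β + 9 / K * 2 ^ n := by field_simp

theorem deltaD_le_hdist {f g : (Fin n → ZMod 2) → ZMod 2} (hg : degLE n d g) :
    deltaD n d f ≤ hdist n f g := by
  refine csInf_le ⟨0, ?_⟩ ⟨g, hg, rfl⟩
  rintro r ⟨g, -, rfl⟩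
  unfold hdist
  positivity

theorem card_span_of_linearIndependent {κ : Type*} [Fintype κ] {v : κ → Fin n → ZMod 2}
    (hv : LinearIndependent (ZMod 2) v) :
    Fintype.card (Submodule.span (ZMod 2) (Set.range v)) = 2 ^ Fintype.card κ := by
  rw [Module.card_eq_pow_finrank (K := ZMod 2), finrank_span_eq_card hv, ZMod.card]

end

theorem statement7 (n d K : ℕ) (f : (Fin n → ZMod 2) → ZMod 2)
    (L : Fin K → Fin n → ZMod 2) (b : Fin K → ZMod 2)
    (hL : ∀ i, L i ≠ 0)
    (hdistinct : Function.Injective fun i => (L i, b i))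
    (P : Fin K → (Fin n → ZMod 2) → ZMod 2) (hP : ∀ i, degLE n d (P i))
    (α : ℝ)
    (hclose : ∀ i, ((Finset.univ.filter fun x : Fin n → ZMod 2 =>
        x ∈ hyp n (L i) (b i) ∧ f x ≠ P i x).card : ℝ) / 2 ^ (n - 1) ≤ α)
    (hK : 2 ^ (d+1) < K) (hα : α < (2:ℝ) ^ (-(d:ℤ) - 2)) :
    deltaD n d f ≤ 3 / 2 * α + 9 / K := by
  have hKpos : 0 < K := lt_trans (by positivity) hK
  have hn : 1 ≤ n := by
    obtain ⟨k, -⟩ := Function.ne_iff.mp (hL ⟨0, hKpos⟩)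
    exact k.pos
  have hn2 : (2 : ℝ) ^ n = 2 * 2 ^ (n - 1) := by rw [← pow_succ', Nat.sub_add_cancel hn]
  let err : Fin K → Finset (Fin n → ZMod 2) := fun i =>
    Finset.univ.filter fun x => x ∈ hyp n (L i) (b i) ∧ f x ≠ P i x
  have herr : ∀ i, ((err i).card : ℝ) ≤ α * 2 ^ (n - 1) := fun i =>
    (div_le_iff₀ (by positivity)).mp (hclose i)
  have hαd : α * 2 ^ (d + 2) < 1 := by
    have hpow : (2 : ℝ) ^ (-(d : ℤ) - 2) * 2 ^ (d + 2) = 1 := by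
      rw [← zpow_natCast, ← zpow_add₀ two_ne_zero]
      simp
    exact hpow ▸ mul_lt_mul_of_pos_right hα (by positivity)
  have herr_lt : ∀ i, 2 ^ (d + 3) * (err i).card < 2 ^ n := by
    intro i
    have h : (2 : ℝ) ^ (d + 3) * (err i).card < 2 ^ n :=
      calc (2 : ℝ) ^ (d + 3) * (err i).card ≤ 2 ^ (d + 3) * (α * 2 ^ (n - 1)) := by
            gcongr
            exact herr i
        _ = α * 2 ^ (d + 2) * 2 ^ n := by rw [hn2]; ring
        _ < 1 * 2 ^ n := by gcongr
        _ = 2 ^ n := one_mul _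
    exact_mod_cast h
  have hagree : ∀ i j x, x ∈ hyp n (L i) (b i) → x ∈ hyp n (L j) (b j) → P i x = P j x := by
    intro i j x hxi hxj
    refine eq_on_hyp_inter (hP i) (hP j) ?_ hxi hxj
    have hsub : (Finset.univ.filter fun x =>
        x ∈ hyp n (L i) (b i) ∧ x ∈ hyp n (L j) (b j) ∧ P i x ≠ P j x) ⊆ err i ∪ err j := by
      intro y hy
      simp only [Finset.mem_filter, Finset.mem_univ, true_and, Finset.mem_union, err] at hy ⊢
      by_cases h : f y = P i y
      · exact Or.inr ⟨hy.2.1, fun h' => hy.2.2 (h.symm.trans h')⟩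
      · exact Or.inl ⟨hy.1, h⟩
    have hcard := (Finset.card_le_card hsub).trans (Finset.card_union_le _ _)
    have hi := herr_lt i
    have hj := herr_lt j
    have hmul := Nat.mul_le_mul_left (2 ^ (d + 2)) hcard
    rw [pow_succ _ (d + 2)] at hi hj
    linarith
  obtain ⟨κ, a, ha, hspan, hind⟩ := exists_linearIndependent' (ZMod 2) L
  have : Finite κ := Finite.of_injective a ha
  have : Fintype κ := Fintype.ofFinite κ
  obtain ⟨v, hv⟩ := exists_dual_vectors hind
  obtain ⟨Q, hQ, hQP⟩ := exists_degLE_glue (L ∘ a) (b ∘ a) (P ∘ a) (fun i => hP (a i)) v hv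
    (fun i j => hagree (a i) (a j)) Finset.univ
  let U : Finset (Fin n → ZMod 2) :=
    Finset.univ.filter fun x => ∀ i, x ∉ hyp n ((L ∘ a) i) ((b ∘ a) i)
  have hU : 2 ^ Fintype.card κ * U.card ≤ 2 ^ n := two_pow_mul_card_uncovered_le _ _ v hv
  have hQU : ∀ i, ∀ x ∈ hyp n (L i) (b i), P i x ≠ Q x → x ∈ U := by
    intro i x hx hne
    refine Finset.mem_filter.mpr ⟨Finset.mem_univ _, fun j hj => hne ?_⟩
    rw [hQP j (Finset.mem_univ _) x hj]
    exact hagree _ _ _ hx hj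
  have hspan_card : Fintype.card (Submodule.span (ZMod 2) (Set.range L)) =
      2 ^ Fintype.card κ := by
    rw [← card_span_of_linearIndependent hind]
    exact Fintype.card_congr (Equiv.setCongr (congrArg _ hspan.symm))
  refine (deltaD_le_hdist hQ).trans ?_
  unfold hdist
  rw [div_le_iff₀ (by positivity)]
  rcases le_or_gt (d + 2) (Fintype.card κ) with hcard | hcard
  · have hQi : ∀ i, ∀ x ∈ hyp n (L i) (b i), P i x = Q x := by
      intro i x hx
      refine eq_on_hyp (hP i) hQ ?_ hx
      have hsub : (Finset.univ.filter fun x => x ∈ hyp n (L i) (b i) ∧ P i x ≠ Q x) ⊆ U := by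
        intro y hy
        exact hQU i y (Finset.mem_filter.mp hy).2.1 (Finset.mem_filter.mp hy).2.2
      refine (Nat.mul_le_mul_left _ (Finset.card_le_card hsub)).trans_lt ?_
      have hle : 2 ^ (d + 2) * U.card ≤ 2 ^ n :=
        (Nat.mul_le_mul_right _ (Nat.pow_le_pow_right two_pos hcard)).trans hU
      have hpos : 0 < 2 ^ n := by positivity
      rw [pow_succ] at hle
      linarith
    refine (card_le_of_card_hyp_le hKpos L b hdistinct _ (α * 2 ^ (n - 1)) fun i => ?_).trans
      (le_of_eq (by rw [hn2]; ring))
    refine le_trans (Nat.cast_le.mpr (Finset.card_le_card fun x hx => ?_)) (herr i)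
    simp only [Finset.mem_filter, Finset.mem_univ, true_and, err] at hx ⊢
    exact ⟨hx.2, hQi i x hx.2 ▸ hx.1⟩
  · have hnotinj : ¬ Function.Injective L := by
      intro hinj
      have hle := Fintype.card_le_of_injective
        (fun i => (⟨L i, Submodule.subset_span ⟨i, rfl⟩⟩ :
          Submodule.span (ZMod 2) (Set.range L)))
        fun i j h => hinj (congrArg Subtype.val h)
      rw [Fintype.card_fin, hspan_card] at hle
      have := Nat.pow_le_pow_right two_pos (Nat.le_of_lt_succ hcard)
      omega
    have hKle : K ≤ 2 ^ Fintype.card κ * 2 := by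
      have hle := Fintype.card_le_of_injective
        (fun i => ((⟨L i, Submodule.subset_span ⟨i, rfl⟩⟩, b i) :
          Submodule.span (ZMod 2) (Set.range L) × ZMod 2))
        fun i j h => hdistinct (Prod.ext (congrArg (fun p => (p.1 : Fin n → ZMod 2)) h)
          (congrArg Prod.snd h :))
      rwa [Fintype.card_fin, Fintype.card_prod, hspan_card, ZMod.card] at hle
    obtain ⟨i, j, hLij, hij⟩ : ∃ i j, L i = L j ∧ i ≠ j := by
      simpa [Function.Injective] using hnotinj
    have hbij : b i ≠ b j := fun h => hij (hdistinct (Prod.ext hLij h))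
    have hcover : ∀ x, x ∈ hyp n (L i) (b i) ∨ x ∈ hyp n (L j) (b j) := by
      intro x
      have htwo : ∀ u w w' : ZMod 2, w ≠ w' → u = w ∨ u = w' := by decide
      rw [← hLij]
      exact htwo _ _ _ hbij
    have hsub : (Finset.univ.filter fun x => f x ≠ Q x) ⊆ (err i ∪ err j) ∪ U := by
      intro x hx
      have hfQ := (Finset.mem_filter.mp hx).2
      have hmem : ∀ k, x ∈ hyp n (L k) (b k) → x ∈ err k ∨ x ∈ U := by
        intro k hk
        by_cases h : f x = P k x
        · exact Or.inr (hQU k x hk (h ▸ hfQ))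
        · exact Or.inl (Finset.mem_filter.mpr ⟨Finset.mem_univ _, hk, h⟩)
      simp only [Finset.mem_union]
      have hi := hmem i
      have hj := hmem j
      have hx := hcover x
      tauto
    have hcount : ((Finset.univ.filter fun x => f x ≠ Q x).card : ℝ) ≤
        (err i).card + (err j).card + U.card := by
      exact_mod_cast (Finset.card_le_card hsub).trans ((Finset.card_union_le _ _).trans
        (Nat.add_le_add_right (Finset.card_union_le _ _) _))
    have hKU : (U.card : ℝ) ≤ 2 / K * 2 ^ n := by
      rw [div_mul_eq_mul_div, le_div_iff₀ (Nat.cast_pos.mpr hKpos)]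
      have h : U.card * K ≤ 2 * 2 ^ n :=
        calc U.card * K ≤ U.card * (2 ^ Fintype.card κ * 2) := Nat.mul_le_mul_left _ hKle
          _ = 2 * (2 ^ Fintype.card κ * U.card) := by ring
          _ ≤ 2 * 2 ^ n := Nat.mul_le_mul_left _ hU
      exact_mod_cast h
    have hα0 : 0 ≤ α * 2 ^ (n - 1) := (Nat.cast_nonneg _).trans (herr i)
    have hslack : (0 : ℝ) ≤ 7 / K * 2 ^ n := by positivity
    have hi := herr i
    have hj := herr j
    calc ((Finset.univ.filter fun x => f x ≠ Q x).card : ℝ)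
        ≤ 3 * (α * 2 ^ (n - 1)) + (2 / K * 2 ^ n + 7 / K * 2 ^ n) := by linarith
      _ = (3 / 2 * α + 9 / K) * 2 ^ n := by rw [hn2]; ring

end
end

section
/- Let A and B be distinct, non-complementary hyperplanes of F₂ⁿ, let f : F₂ⁿ → F₂, and let P, Q : F₂ⁿ → F₂ have degree at most d. If Pr_{x uniform in A}[f(x) ≠ P(x)] ≤ α, Pr_{x uniform in B}[f(x) ≠ Q(x)] ≤ α, and 4α < 2^{−d}, then P(x) = Q(x) for every x ∈ A ∩ B. -/
open scoped Classical

noncomputable section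

/-- A polynomial over `𝔽₂` in `n + 1` variables agrees, as a function, with `p₀ + x₀ * p₁` where
`p₀`, `p₁` do not involve `x₀`, and `p₁` is zero or of degree smaller than that of the polynomial. -/
theorem exists_eval_cons_zero_one {n D : ℕ} (p : MvPolynomial (Fin (n + 1)) (ZMod 2))
    (hp : p.totalDegree ≤ D) :
    ∃ p₀ p₁ : MvPolynomial (Fin n) (ZMod 2), p₀.totalDegree ≤ D ∧
      (p₁ = 0 ∨ p₁.totalDegree + 1 ≤ D) ∧
      (∀ s, MvPolynomial.eval (Fin.cons 0 s) p = MvPolynomial.eval s p₀) ∧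
      (∀ s, MvPolynomial.eval (Fin.cons 1 s) p =
        MvPolynomial.eval s p₀ + MvPolynomial.eval s p₁) := by
  set q := MvPolynomial.finSuccEquiv (ZMod 2) n p with hq
  have hcoeff : ∀ k, q.coeff k ≠ 0 → (q.coeff k).totalDegree + k ≤ D := fun k hk =>
    (MvPolynomial.totalDegree_coeff_finSuccEquiv_add_le p k hk).trans hp
  refine ⟨q.coeff 0, ∑ k ∈ Finset.range q.natDegree, q.coeff (k + 1), ?_, ?_, ?_, ?_⟩
  · by_cases h : q.coeff 0 = 0
    · simp [h]
    · simpa using hcoeff 0 h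
  · rcases Nat.eq_zero_or_pos D with rfl | hD
    · left
      refine Finset.sum_eq_zero fun k _ => ?_
      by_contra h
      have := hcoeff _ h
      omega
    · right
      have : (∑ k ∈ Finset.range q.natDegree, q.coeff (k + 1)).totalDegree ≤ D - 1 := by
        refine MvPolynomial.totalDegree_finsetSum_le fun k _ => ?_
        by_cases h : q.coeff (k + 1) = 0
        · simp [h]
        · have := hcoeff _ h
          omega
      omega
  · intro s
    rw [MvPolynomial.eval_eq_eval_mv_eval', ← hq, ← Polynomial.coeff_zero_eq_eval_zero,
      Polynomial.coeff_map]
  · intro s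
    rw [MvPolynomial.eval_eq_eval_mv_eval', ← hq, Polynomial.eval_map,
      Polynomial.eval₂_eq_sum_range, Finset.sum_range_succ']
    simp [add_comm]

theorem card_filter_fin_cons {n : ℕ} (r : (Fin (n + 1) → ZMod 2) → Prop)
    [DecidablePred r] :
    (Finset.univ.filter r).card =
      (Finset.univ.filter fun s : Fin n → ZMod 2 => r (Fin.cons 0 s)).card +
      (Finset.univ.filter fun s : Fin n → ZMod 2 => r (Fin.cons 1 s)).card := by
  simp only [Finset.card_filter]
  rw [← (Fin.consEquiv fun _ : Fin (n + 1) => ZMod 2).sum_comp, Fintype.sum_prod_type]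
  exact Fin.sum_univ_two _

/-- The minimum distance of the Reed–Muller code. -/
theorem two_pow_le_two_pow_mul_card_eval_ne_zero {n D : ℕ} (p : MvPolynomial (Fin n) (ZMod 2))
    (hp : p.totalDegree ≤ D) (hne : ∃ x, MvPolynomial.eval x p ≠ 0) :
    2 ^ n ≤ 2 ^ D * (Finset.univ.filter fun x => MvPolynomial.eval x p ≠ 0).card := by
  induction n generalizing D with
  | zero =>
    obtain ⟨x, hx⟩ := hne
    have : 0 < (Finset.univ.filter fun x => MvPolynomial.eval x p ≠ 0).card :=
      Finset.card_pos.mpr ⟨x, Finset.mem_filter.mpr ⟨Finset.mem_univ x, hx⟩⟩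
    exact Nat.mul_pos (by positivity) this
  | succ n ih =>
    obtain ⟨p₀, p₁, h₀, h₁, e₀, e₁⟩ := exists_eval_cons_zero_one p hp
    rw [card_filter_fin_cons]
    simp only [e₀, e₁]
    by_cases hz : ∃ s, MvPolynomial.eval s p₁ ≠ 0
    · obtain ⟨E, rfl⟩ : ∃ E, D = E + 1 := by
        rcases h₁ with rfl | h
        · simp at hz
        · exact ⟨D - 1, by omega⟩
      have key := ih (D := E) p₁ (by
        rcases h₁ with rfl | h
        · simp
        · omega) hz
      have hsub : (Finset.univ.filter fun s => MvPolynomial.eval s p₁ ≠ 0) ⊆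
          (Finset.univ.filter fun s => MvPolynomial.eval s p₀ ≠ 0) ∪
          (Finset.univ.filter fun s =>
            MvPolynomial.eval s p₀ + MvPolynomial.eval s p₁ ≠ 0) := by
        intro s
        simp only [Finset.mem_filter, Finset.mem_univ, true_and, Finset.mem_union]
        intro hs
        by_contra! h
        exact hs (by simpa [h.1] using h.2)
      have hcard := (Finset.card_le_card hsub).trans (Finset.card_union_le _ _)
      calc 2 ^ (n + 1) = 2 * 2 ^ n := by ring
        _ ≤ 2 * (2 ^ E * _) := Nat.mul_le_mul_left _ (key.trans (Nat.mul_le_mul_left _ hcard))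
        _ = _ := by ring
    · push Not at hz
      have h₀ne : ∃ s, MvPolynomial.eval s p₀ ≠ 0 := by
        obtain ⟨x, hx⟩ := hne
        refine ⟨Fin.tail x, fun h => hx ?_⟩
        rw [← Fin.cons_self_tail x]
        rcases (by decide : ∀ a : ZMod 2, a = 0 ∨ a = 1) (x 0) with h0 | h0 <;>
          simp [h0, e₀, e₁, h, hz]
      have key := ih p₀ h₀ h₀ne
      simp only [hz, add_zero]
      calc 2 ^ (n + 1) = 2 * 2 ^ n := by ring
        _ ≤ 2 * (2 ^ D * _) := Nat.mul_le_mul_left _ key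
        _ = _ := by ring

/-- The indicator function of a hyperplane over `𝔽₂` is a polynomial of degree at most `1`. -/
theorem exists_eval_ne_zero_iff_mem_hyp (n : ℕ) (L : Fin n → ZMod 2) (b : ZMod 2) :
    ∃ p : MvPolynomial (Fin n) (ZMod 2), p.totalDegree ≤ 1 ∧
      ∀ x, MvPolynomial.eval x p ≠ 0 ↔ x ∈ hyp n L b := by
  refine ⟨∑ i, MvPolynomial.C (L i) * MvPolynomial.X i + MvPolynomial.C (b + 1), ?_, fun x => ?_⟩
  · refine (MvPolynomial.totalDegree_add _ _).trans
      (max_le ?_ ((MvPolynomial.totalDegree_C _).trans_le zero_le_one))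
    refine MvPolynomial.totalDegree_finsetSum_le fun i _ => ?_
    refine (MvPolynomial.totalDegree_mul _ _).trans ?_
    simp
  · simp only [map_add, map_sum, map_mul, MvPolynomial.eval_C, MvPolynomial.eval_X, hyp,
      Set.mem_ofPred_eq]
    generalize ∑ i, L i * x i = a
    revert a b
    decide

theorem statement8 (n d : ℕ) (f P Q : (Fin n → ZMod 2) → ZMod 2)
    (L₁ L₂ : Fin n → ZMod 2) (b₁ b₂ : ZMod 2)
    (hL₁ : L₁ ≠ 0) (hL₂ : L₂ ≠ 0)
    (hne : hyp n L₁ b₁ ≠ hyp n L₂ b₂)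
    (hnotcompl : hyp n L₁ b₁ ∪ hyp n L₂ b₂ ≠ Set.univ)
    (hdP : degLE n d P) (hdQ : degLE n d Q) (α : ℝ)
    (hA : ((Finset.univ.filter fun x : Fin n → ZMod 2 =>
        x ∈ hyp n L₁ b₁ ∧ f x ≠ P x).card : ℝ) / 2 ^ (n - 1) ≤ α)
    (hB : ((Finset.univ.filter fun x : Fin n → ZMod 2 =>
        x ∈ hyp n L₂ b₂ ∧ f x ≠ Q x).card : ℝ) / 2 ^ (n - 1) ≤ α)
    (hα : 4 * α < (2:ℝ) ^ (-(d:ℤ))) :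
    ∀ x ∈ hyp n L₁ b₁ ∩ hyp n L₂ b₂, P x = Q x := by
  rintro x₀ ⟨hx₁, hx₂⟩
  by_contra hPQ
  obtain ⟨p, hp, ep⟩ := hdP
  obtain ⟨q, hq, eq⟩ := hdQ
  obtain ⟨l₁, hl₁, el₁⟩ := exists_eval_ne_zero_iff_mem_hyp n L₁ b₁
  obtain ⟨l₂, hl₂, el₂⟩ := exists_eval_ne_zero_iff_mem_hyp n L₂ b₂
  have hsupp : ∀ x, MvPolynomial.eval x ((p - q) * l₁ * l₂) ≠ 0 ↔
      (P x ≠ Q x ∧ x ∈ hyp n L₁ b₁) ∧ x ∈ hyp n L₂ b₂ := by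
    intro x
    rw [map_mul, map_mul, mul_ne_zero_iff, mul_ne_zero_iff, el₁, el₂, map_sub, ep, eq, sub_ne_zero]
  have hdeg : ((p - q) * l₁ * l₂).totalDegree ≤ d + 2 := by
    have h1 := MvPolynomial.totalDegree_mul ((p - q) * l₁) l₂
    have h2 := MvPolynomial.totalDegree_mul (p - q) l₁
    have h3 := (MvPolynomial.totalDegree_sub p q).trans (max_le hp hq)
    omega
  have key := two_pow_le_two_pow_mul_card_eval_ne_zero _ hdeg
    ⟨x₀, (hsupp x₀).mpr ⟨⟨hPQ, hx₁⟩, hx₂⟩⟩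
  have hsub : (Finset.univ.filter fun x => MvPolynomial.eval x ((p - q) * l₁ * l₂) ≠ 0) ⊆
      (Finset.univ.filter fun x => x ∈ hyp n L₁ b₁ ∧ f x ≠ P x) ∪
      (Finset.univ.filter fun x => x ∈ hyp n L₂ b₂ ∧ f x ≠ Q x) := by
    intro x
    simp only [Finset.mem_filter, Finset.mem_univ, true_and, Finset.mem_union, hsupp]
    rintro ⟨⟨hne, h1⟩, h2⟩
    by_cases h : f x = P x
    · exact Or.inr ⟨h2, h ▸ hne⟩
    · exact Or.inl ⟨h1, h⟩
  have hcard := (Finset.card_le_card hsub).trans (Finset.card_union_le _ _)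
  obtain ⟨m, rfl⟩ : ∃ m, n = m + 1 := by
    rcases n with _ | m
    · exact absurd (Subsingleton.elim _ _) hL₁
    · exact ⟨m, rfl⟩
  have hle := key.trans (Nat.mul_le_mul_left _ hcard)
  rw [div_le_iff₀ (by positivity), Nat.add_sub_cancel] at hA hB
  have hle' : (2 : ℝ) ^ (m + 1) ≤ 2 ^ (d + 2) * (α * 2 ^ m + α * 2 ^ m) := by
    refine le_trans (by exact_mod_cast hle) (mul_le_mul_of_nonneg_left (add_le_add hA hB) ?_)
    positivity
  rw [zpow_neg, zpow_natCast, ← one_div, lt_div_iff₀ (by positivity)] at hα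
  have hlt := mul_lt_mul_of_pos_right hα (by positivity : (0 : ℝ) < 2 ^ (m + 1))
  have heq : 4 * α * 2 ^ d * (2 : ℝ) ^ (m + 1) = 2 ^ (d + 2) * (α * 2 ^ m + α * 2 ^ m) := by
    ring
  linarith

end
end

section
/- Let A₁, …, A_K be distinct hyperplanes of F₂ⁿ. Then the fraction of points z ∈ F₂ⁿ that are contained in fewer than K/3 of the hyperplanes A₁, …, A_K is at most 9/K. -/
open scoped Classical

noncomputable section

/-- The `±1`-valued indicator of the hyperplane `{x : L·x = b}`. -/
def hypSign (n : ℕ) (L : Fin n → ZMod 2) (b : ZMod 2) (z : Fin n → ZMod 2) : ℝ :=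
  if z ∈ hyp n L b then 1 else -1

lemma hypSign_mul_self (n : ℕ) (L : Fin n → ZMod 2) (b : ZMod 2) (z : Fin n → ZMod 2) :
    hypSign n L b z * hypSign n L b z = 1 := by
  unfold hypSign
  split_ifs <;> norm_num

lemma mem_hyp_iff (n : ℕ) (L : Fin n → ZMod 2) (b : ZMod 2) (z : Fin n → ZMod 2) :
    z ∈ hyp n L b ↔ L ⬝ᵥ z = b := Iff.rfl

lemma hypSign_add_single (n : ℕ) (L : Fin n → ZMod 2) (b : ZMod 2) (z : Fin n → ZMod 2)
    (k : Fin n) :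
    hypSign n L b (z + Pi.single k 1) = (if L k = 0 then 1 else -1) * hypSign n L b z := by
  simp only [hypSign, mem_hyp_iff, dotProduct_add, dotProduct_single, mul_one]
  generalize L ⬝ᵥ z = s
  generalize L k = t
  have flip : ∀ s b : ZMod 2, s + 1 = b ↔ ¬ s = b := by decide
  have cases_t : t = 0 ∨ t = 1 := by revert t; decide
  rcases cases_t with rfl | rfl
  · simp
  · by_cases h : s = b <;> simp [flip, h]

lemma sum_hypSign_mul_eq_zero (n : ℕ) (L L' : Fin n → ZMod 2) (b b' : ZMod 2) (h : L ≠ L') :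
    ∑ z, hypSign n L b z * hypSign n L' b' z = 0 := by
  obtain ⟨k, hk⟩ := Function.ne_iff.mp h
  have sign : ((if L k = 0 then 1 else -1) * (if L' k = 0 then 1 else -1) : ℝ) = -1 := by
    have key : ∀ s t : ZMod 2, s ≠ t → (s = 0 ↔ ¬ t = 0) := by decide
    by_cases h0 : L' k = 0 <;> simp [key _ _ hk, h0]
  have shift := Equiv.sum_comp (Equiv.addRight (Pi.single k (1 : ZMod 2)))
    fun z => hypSign n L b z * hypSign n L' b' z
  simp only [Equiv.coe_addRight, hypSign_add_single] at shift
  simp_rw [mul_mul_mul_comm _ (hypSign n L b _), sign, ← Finset.mul_sum] at shift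
  linarith

lemma hypSign_mul_of_ne (n : ℕ) (L : Fin n → ZMod 2) {b b' : ZMod 2} (h : b ≠ b')
    (z : Fin n → ZMod 2) : hypSign n L b z * hypSign n L b' z = -1 := by
  have key : ∀ s b b' : ZMod 2, b ≠ b' → (s = b ↔ ¬ s = b') := by decide
  simp only [hypSign, mem_hyp_iff, key _ _ _ h]
  by_cases h' : L ⬝ᵥ z = b' <;> simp [h']

lemma sum_hypSign_mul_nonpos (n : ℕ) (L L' : Fin n → ZMod 2) (b b' : ZMod 2)
    (h : (L, b) ≠ (L', b')) : ∑ z, hypSign n L b z * hypSign n L' b' z ≤ 0 := by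
  by_cases hL : L = L'
  · subst hL
    have hb : b ≠ b' := fun hb => h (by rw [hb])
    simp [hypSign_mul_of_ne n L hb]
  · exact (sum_hypSign_mul_eq_zero n L L' b b' hL).le

lemma sum_sq_sum_hypSign_le (n K : ℕ) (L : Fin K → Fin n → ZMod 2) (b : Fin K → ZMod 2)
    (hdistinct : Function.Injective fun i => (L i, b i)) :
    ∑ z, (∑ i, hypSign n (L i) (b i) z) ^ 2 ≤ K * 2 ^ n := by
  calc ∑ z, (∑ i, hypSign n (L i) (b i) z) ^ 2
      = ∑ i, ∑ j, ∑ z, hypSign n (L i) (b i) z * hypSign n (L j) (b j) z := by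
        simp only [sq, Finset.sum_mul_sum]
        rw [Finset.sum_comm]
        exact Finset.sum_congr rfl fun i _ => Finset.sum_comm
    _ ≤ ∑ i : Fin K, ∑ j : Fin K, if i = j then (2 : ℝ) ^ n else 0 := by
        gcongr with i _ j _
        split_ifs with hij
        · subst hij
          simp [hypSign_mul_self]
        · exact sum_hypSign_mul_nonpos n _ _ _ _ (hdistinct.ne hij)
    _ = K * 2 ^ n := by simp

lemma sum_hypSign_eq (n K : ℕ) (L : Fin K → Fin n → ZMod 2) (b : Fin K → ZMod 2)
    (z : Fin n → ZMod 2) :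
    ∑ i, hypSign n (L i) (b i) z =
      2 * ((Finset.univ.filter fun i : Fin K => z ∈ hyp n (L i) (b i)).card : ℝ) - K := by
  have h : ∀ i, hypSign n (L i) (b i) z = 2 * (if z ∈ hyp n (L i) (b i) then 1 else 0) - 1 := by
    intro i
    unfold hypSign
    split_ifs <;> norm_num
  simp only [h, Finset.sum_sub_distrib, ← Finset.mul_sum, Finset.sum_boole]
  simp

theorem statement9 (n K : ℕ) (L : Fin K → Fin n → ZMod 2) (b : Fin K → ZMod 2)
    (hL : ∀ i, L i ≠ 0)
    (hdistinct : Function.Injective fun i => (L i, b i)) :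
    ((Finset.univ.filter fun z : Fin n → ZMod 2 =>
        ((Finset.univ.filter fun i : Fin K => z ∈ hyp n (L i) (b i)).card : ℝ)
          < K / 3).card : ℝ) / 2 ^ n ≤ 9 / K := by
  rcases Nat.eq_zero_or_pos K with rfl | hK
  · simp
  have hK' : (0 : ℝ) < K := by exact_mod_cast hK
  set S := Finset.univ.filter fun z : Fin n → ZMod 2 =>
    ((Finset.univ.filter fun i : Fin K => z ∈ hyp n (L i) (b i)).card : ℝ) < K / 3
  have lower : (S.card : ℝ) * (K / 3) ^ 2 ≤ ∑ z, (∑ i, hypSign n (L i) (b i) z) ^ 2 := by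
    calc (S.card : ℝ) * (K / 3) ^ 2 = ∑ z ∈ S, ((K : ℝ) / 3) ^ 2 := by simp
      _ ≤ ∑ z ∈ S, (∑ i, hypSign n (L i) (b i) z) ^ 2 := by
        refine Finset.sum_le_sum fun z hz => ?_
        have hz' := (Finset.mem_filter.mp hz).2
        rw [sum_hypSign_eq]
        nlinarith
      _ ≤ ∑ z, (∑ i, hypSign n (L i) (b i) z) ^ 2 :=
        Finset.sum_le_sum_of_subset_of_nonneg (Finset.subset_univ S) fun _ _ _ => sq_nonneg _
  have upper := lower.trans (sum_sq_sum_hypSign_le n K L b hdistinct)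
  rw [div_le_div_iff₀ (by positivity) hK']
  refine le_of_mul_le_mul_right ?_ hK'
  linarith

end
end

section
/- Let k ≥ d+1 and let f : F₂^{k+1} → F₂ have degree greater than d. Then Rej_{d,k}(f) ≥ 1/2; equivalently, for at least half of the hyperplanes A of F₂^{k+1}, the restriction f|_A does not have degree at most d. -/
open scoped Classical

noncomputable section

namespace degLE

variable {n m d e : ℕ} {f g : (Fin n → ZMod 2) → ZMod 2}

lemma mono_s10 (hf : degLE n d f) (h : d ≤ e) : degLE n e f :=
  let ⟨p, hp, hpf⟩ := hf
  ⟨p, hp.trans h, hpf⟩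

lemma congr (hf : degLE n d f) (h : ∀ x, f x = g x) : degLE n d g :=
  funext h ▸ hf

lemma const (n d : ℕ) (c : ZMod 2) : degLE n d fun _ => c :=
  ⟨MvPolynomial.C c, by simp, by simp⟩

lemma add_s10 (hf : degLE n d f) (hg : degLE n d g) : degLE n d fun x => f x + g x := by
  obtain ⟨p, hp, hpf⟩ := hf
  obtain ⟨q, hq, hqg⟩ := hg
  exact ⟨p + q, (MvPolynomial.totalDegree_add p q).trans (max_le hp hq), by simp [hpf, hqg]⟩

lemma mul_s10 (hf : degLE n d f) (hg : degLE n e g) : degLE n (d + e) fun x => f x * g x := by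
  obtain ⟨p, hp, hpf⟩ := hf
  obtain ⟨q, hq, hqg⟩ := hg
  exact ⟨p * q, (MvPolynomial.totalDegree_mul p q).trans (add_le_add hp hq), by simp [hpf, hqg]⟩

lemma const_mul (hf : degLE n d f) (c : ZMod 2) : degLE n d fun x => c * f x := by
  simpa using (const n 0 c).mul_s10 hf

lemma sum {ι : Type*} {s : Finset ι} {F : ι → (Fin n → ZMod 2) → ZMod 2}
    (hF : ∀ i ∈ s, degLE n d (F i)) : degLE n d fun x => ∑ i ∈ s, F i x := by
  induction s using Finset.cons_induction with
  | empty => simpa using const n d 0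
  | cons a s ha ih =>
    simp only [Finset.sum_cons]
    exact (hF a (Finset.mem_cons_self a s)).add_s10
      (ih fun i hi => hF i (Finset.mem_cons_of_mem hi))

lemma multiset_prod {ι : Type*} {F : ι → (Fin n → ZMod 2) → ZMod 2}
    (hF : ∀ i, degLE n 1 (F i)) (s : Multiset ι) :
    degLE n s.card fun x => (s.map fun i => F i x).prod := by
  induction s using Multiset.induction_on with
  | empty => simpa using const n 0 1
  | cons a s ih =>
    simp only [Multiset.map_cons, Multiset.prod_cons, Multiset.card_cons]
    exact ((hF a).mul_s10 ih).mono_s10 (add_comm _ _).le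

lemma coord (i : Fin n) : degLE n 1 fun x => x i :=
  ⟨MvPolynomial.X i, by simp, by simp⟩

lemma linear (L : (Fin n → ZMod 2) →ₗ[ZMod 2] ZMod 2) : degLE n 1 L := by
  have h : (L : (Fin n → ZMod 2) → ZMod 2) = fun x => ∑ i, L (Pi.single i 1) * x i := by
    funext x
    conv_lhs => rw [LinearMap.pi_apply_eq_sum_univ L x]
    refine Finset.sum_congr rfl fun i _ => ?_
    rw [smul_eq_mul, mul_comm]
    congr 2
    funext j
    simp [Pi.single_apply, eq_comm]
  rw [h]
  exact sum fun i _ => (coord i).const_mul _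

/-- A function of degree at most `d` is a sum of monomials of degree at most `d`. -/
lemma exists_eq_sum (hf : degLE n d f) : ∃ (S : Finset (Multiset (Fin n))),
    (∀ s ∈ S, s.card ≤ d) ∧ ∃ c : Multiset (Fin n) → ZMod 2,
      f = fun x => ∑ s ∈ S, c s * (s.map x).prod := by
  obtain ⟨p, hp, hpf⟩ := hf
  refine ⟨p.support.map Multiset.toFinsupp.symm.toEquiv.toEmbedding, ?_,
    fun s => p.coeff (Multiset.toFinsupp s), ?_⟩
  · simp only [Finset.mem_map]
    rintro _ ⟨s, hs, rfl⟩
    have := (MvPolynomial.le_totalDegree hs).trans hp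
    exact (Finsupp.card_toMultiset s).trans_le this
  · funext x
    rw [← hpf, MvPolynomial.eval_eq, Finset.sum_map]
    refine Finset.sum_congr rfl fun s _ => ?_
    have : (Multiset.map x (Finsupp.toMultiset s)).prod = ∏ i ∈ s.support, x i ^ s i := by
      rw [Finsupp.toMultiset_map, Finsupp.prod_toMultiset, Finsupp.prod_mapDomain_index] <;>
        simp [Finsupp.prod, pow_add]
    rw [← this]
    simp

lemma comp_s10 (hf : degLE n d f) {φ : (Fin m → ZMod 2) → Fin n → ZMod 2}
    (hφ : ∀ i, degLE m 1 fun x => φ x i) : degLE m d fun x => f (φ x) := by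
  obtain ⟨S, hS, c, rfl⟩ := hf.exists_eq_sum
  exact sum fun s hs => ((multiset_prod hφ s).mono_s10 (hS s hs)).const_mul _

lemma comp_affine (hf : degLE n d f) (A : (Fin m → ZMod 2) →ₗ[ZMod 2] Fin n → ZMod 2)
    (b : Fin n → ZMod 2) : degLE m d fun x => f (A x + b) :=
  hf.comp_s10 fun i => (linear (LinearMap.proj i ∘ₗ A)).add_s10 (const m 1 (b i))

lemma translate (hf : degLE n d f) (w : Fin n → ZMod 2) : degLE n d fun x => f (x + w) :=
  hf.comp_affine LinearMap.id w

lemma deriv (hf : degLE n d f) (w : Fin n → ZMod 2) :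
    degLE n (d - 1) fun x => f (x + w) + f x := by
  obtain ⟨S, hS, c, rfl⟩ := hf.exists_eq_sum
  have key (s : Multiset (Fin n)) :
      degLE n (s.card - 1) fun x => (s.map (x + w)).prod + (s.map x).prod := by
    induction s using Multiset.induction_on with
    | empty => simpa [CharTwo.add_self_eq_zero] using const n 0 0
    | cons a s ih =>
      rcases Nat.eq_zero_or_pos s.card with h | h
      · rw [Multiset.card_eq_zero] at h
        subst h
        refine (const n _ (w a)).congr fun x => ?_
        have := CharTwo.add_self_eq_zero (x a)
        simp only [Multiset.map_cons, Multiset.map_zero, Multiset.prod_cons, Multiset.prod_zero,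
          Pi.add_apply]
        linear_combination -this
      · have h1 : degLE n s.card fun x => w a * (s.map (x + w)).prod :=
          ((multiset_prod coord s).translate w).const_mul _
        have h2 := ((coord a).mul_s10 ih).mono_s10 (show 1 + (s.card - 1) ≤ s.card by lia)
        rw [Multiset.card_cons, Nat.add_sub_cancel]
        refine (h2.add_s10 h1).congr fun x => ?_
        simp only [Multiset.map_cons, Multiset.prod_cons, Pi.add_apply]
        ring
  simp only [← Finset.sum_add_distrib, ← mul_add]
  exact sum fun s hs => ((key s).mono_s10 (Nat.sub_le_sub_right (hS s hs) 1)).const_mul _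

lemma deriv_eq_zero (hf : degLE n 0 f) (w x : Fin n → ZMod 2) : f (x + w) + f x = 0 := by
  obtain ⟨p, hp, hpf⟩ := hf
  rw [← hpf, ← hpf, MvPolynomial.totalDegree_eq_zero_iff_eq_C.1 (Nat.le_zero.1 hp),
    MvPolynomial.eval_C, MvPolynomial.eval_C, CharTwo.add_self_eq_zero]

lemma mul_deriv (hf : degLE n d f) (hg : degLE n 1 g) (w : Fin n → ZMod 2) :
    degLE n d fun x => g x * (f (x + w) + f x) := by
  rcases d with _ | d
  · simpa only [hf.deriv_eq_zero, mul_zero] using const n 0 0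
  · exact (hg.mul_s10 (hf.deriv w)).mono_s10 (by lia)

end degLE

/-- Modulo functions of degree at most `d`, `f` is a multiple of the linear form `L` with
quotient of degree at most `d`. -/
def DvdMod (n d : ℕ) (L : (Fin n → ZMod 2) →ₗ[ZMod 2] ZMod 2) (f : (Fin n → ZMod 2) → ZMod 2) :
    Prop :=
  ∃ h g, degLE n d h ∧ degLE n d g ∧ ∀ x, f x = L x * h x + g x

/-- On the hyperplane `L = c`, the function `f` has degree at most `d`. -/
def DegLEOn (n d : ℕ) (L : (Fin n → ZMod 2) →ₗ[ZMod 2] ZMod 2) (c : ZMod 2)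
    (f : (Fin n → ZMod 2) → ZMod 2) : Prop :=
  ∃ g, degLE n d g ∧ ∀ x, L x = c → f x = g x

lemma ZMod.eq_zero_or_eq_one_of_two (a : ZMod 2) : a = 0 ∨ a = 1 := by
  revert a
  decide

section DvdMod

variable {n d : ℕ} {L L' : (Fin n → ZMod 2) →ₗ[ZMod 2] ZMod 2} {f : (Fin n → ZMod 2) → ZMod 2}

lemma exists_apply_eq_one (hL : L ≠ 0) : ∃ v, L v = 1 := by
  obtain ⟨v, hv⟩ := DFunLike.ne_iff.1 hL
  exact ⟨v, (ZMod.eq_zero_or_eq_one_of_two _).resolve_left hv⟩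

lemma eq_of_forall_apply_eq_zero_iff (h : ∀ x, L x = 0 ↔ L' x = 0) : L = L' := by
  refine LinearMap.ext fun x => ?_
  have := h x
  rcases ZMod.eq_zero_or_eq_one_of_two (L x) with h1 | h1 <;>
    rcases ZMod.eq_zero_or_eq_one_of_two (L' x) with h2 | h2 <;> simp_all

lemma exists_apply_eq_one_and_eq_zero (hL : L ≠ 0) (hL' : L' ≠ 0) (h : L ≠ L') :
    ∃ v, L v = 1 ∧ L' v = 0 := by
  by_contra! hv
  replace hv (x) (hx : L' x = 0) : L x = 0 :=
    (ZMod.eq_zero_or_eq_one_of_two _).resolve_right fun h1 => hv x h1 hx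
  obtain ⟨u, hu⟩ := exists_apply_eq_one hL'
  have hxu (x) (hx : L' x = 1) : L x = L u := by
    have := hv (x - u) (by simp [hx, hu])
    rwa [map_sub, sub_eq_zero] at this
  rcases ZMod.eq_zero_or_eq_one_of_two (L u) with h0 | h1
  · refine hL (LinearMap.ext fun x => ?_)
    rcases ZMod.eq_zero_or_eq_one_of_two (L' x) with hx | hx
    · simpa using hv x hx
    · simpa [h0] using hxu x hx
  · refine h (LinearMap.ext fun x => ?_)
    rcases ZMod.eq_zero_or_eq_one_of_two (L' x) with hx | hx
    · rw [hv x hx, hx]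
    · rw [hxu x hx, hx, h1]

lemma DvdMod.degLE (hf : DvdMod n d L f) : degLE n (d + 1) f := by
  obtain ⟨h, g, hh, hg, hfx⟩ := hf
  rw [funext hfx]
  exact (((degLE.linear L).mul_s10 hh).mono_s10 (by lia)).add_s10 (hg.mono_s10 (by lia))

lemma DvdMod.degLEOn (hf : DvdMod n d L f) (c : ZMod 2) : DegLEOn n d L c f := by
  obtain ⟨h, g, hh, hg, hfx⟩ := hf
  exact ⟨_, (hh.const_mul c).add_s10 hg, fun x hx => by rw [hfx, hx]⟩

lemma DegLEOn.dvdMod_of_degLE {c : ZMod 2} (h : DegLEOn n d L c f) (hL : L ≠ 0)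
    (hf : _root_.degLE n (d + 1) f) : DvdMod n d L f := by
  obtain ⟨g, hg, hfg⟩ := h
  obtain ⟨v, hv⟩ := exists_apply_eq_one hL
  have hF := (hf.add_s10 (hg.mono_s10 (Nat.le_succ d))).deriv v
  refine ⟨_, _, hF, (hF.const_mul c).add_s10 hg, fun x => ?_⟩
  have h1 := hfg x
  have h2 := hfg (x + v)
  rw [map_add, hv] at h2
  have := CharTwo.add_self_eq_zero (g x)
  have := CharTwo.add_self_eq_zero (g (x + v))
  rcases ZMod.eq_zero_or_eq_one_of_two (L x) with hx | hx <;>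
    rcases ZMod.eq_zero_or_eq_one_of_two c with hc | hc <;>
    grind

lemma DegLEOn.dvdMod (h0 : DegLEOn n d L 0 f) (h1 : DegLEOn n d L 1 f) : DvdMod n d L f := by
  obtain ⟨g0, hg0, hf0⟩ := h0
  obtain ⟨g1, hg1, hf1⟩ := h1
  refine ⟨_, _, hg0.add_s10 hg1, hg0, fun x => ?_⟩
  have := hf0 x
  have := hf1 x
  rcases ZMod.eq_zero_or_eq_one_of_two (L x) with hx | hx <;> grind

lemma DvdMod.add_s10 (h1 : DvdMod n d L f) (h2 : DvdMod n d L' f) (hL : L ≠ 0) (hL' : L' ≠ 0)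
    (hne : L ≠ L') : DvdMod n d (L + L') f := by
  obtain ⟨p, g, hp, hg, hf1⟩ := h1
  obtain ⟨q, r, hq, hr, hf2⟩ := h2
  obtain ⟨w, hw, hw'⟩ := exists_apply_eq_one_and_eq_zero hL hL' hne
  have hq' := hq.mul_deriv (degLE.linear L) w
  refine ⟨_, _, hq', ((hq'.add_s10 (hr.mul_deriv (degLE.linear L) w)).add_s10
    (hg.mul_deriv (degLE.linear L) w)).add_s10 hg, fun x => ?_⟩
  have e1 := hf1 x
  have e2 := hf2 x
  have e3 := hf1 (x + w)
  have e4 := hf2 (x + w)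
  simp only [map_add, LinearMap.add_apply, hw, hw'] at *
  rcases ZMod.eq_zero_or_eq_one_of_two (L x) with hx | hx <;> grind

lemma DvdMod.deriv (h : DvdMod n (d + 1) L f) {w : Fin n → ZMod 2} (hw : L w = 0) :
    DvdMod n d L fun x => f (x + w) + f x := by
  obtain ⟨h, g, hh, hg, hf⟩ := h
  refine ⟨_, _, hh.deriv w, hg.deriv w, fun x => ?_⟩
  simp only [hf, map_add, hw]
  ring

lemma DvdMod.degLE_of_deriv (h : DvdMod n d L f) {w : Fin n → ZMod 2} (hw : L w = 1)
    (hf : _root_.degLE n d fun x => L x * (f (x + w) + f x)) : _root_.degLE n d f := by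
  obtain ⟨h, g, hh, hg, hfx⟩ := h
  convert (hf.add_s10 (hg.mul_deriv (degLE.linear L) w)).add_s10 hg using 2 with x
  simp only [hfx, map_add, hw]
  rcases ZMod.eq_zero_or_eq_one_of_two (L x) with hx | hx <;> grind

lemma degLE_of_dvdMod_proj (S : Finset (Fin n)) (hS : d + 2 ≤ S.card)
    (h : ∀ i ∈ S, DvdMod n d (LinearMap.proj i) f) : degLE n d f := by
  induction d generalizing f S with
  | zero =>
    obtain ⟨i, hi, j, hj, hij⟩ := Finset.one_lt_card.1 (show 1 < S.card by lia)
    refine (h i hi).degLE_of_deriv (w := Pi.single i 1) (by simp) ?_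
    obtain ⟨p, g, hp, hg, hf⟩ := h j hj
    convert degLE.const n 0 0 using 2 with x
    have e1 := hp.deriv_eq_zero (Pi.single i 1) x
    have e2 := hg.deriv_eq_zero (Pi.single i 1) x
    simp only [hf, map_add, LinearMap.proj_apply, Pi.single_eq_of_ne hij.symm]
    linear_combination x i * (x j * e1 + e2)
  | succ d ih =>
    obtain ⟨i, hi⟩ := Finset.card_pos.1 (show 0 < S.card by lia)
    refine (h i hi).degLE_of_deriv (w := Pi.single i 1) (by simp) ?_
    have := ih (f := fun x => f (x + Pi.single i 1) + f x) (S.erase i)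
      (by rw [Finset.card_erase_of_mem hi]; lia)
      fun j hj => (h j (Finset.mem_of_mem_erase hj)).deriv
        (by simp [Finset.ne_of_mem_erase hj])
    exact ((degLE.linear _).mul_s10 this).mono_s10 (by lia)

end DvdMod

section Flats

variable {k d : ℕ} {M : Matrix (Fin (k + 1)) (Fin k) (ZMod 2)}
  {L : (Fin (k + 1) → ZMod 2) →ₗ[ZMod 2] ZMod 2}

lemma exists_linear_eq_zero_iff_of_injective (hM : Function.Injective M.mulVec) :
    ∃ L : (Fin (k + 1) → ZMod 2) →ₗ[ZMod 2] ZMod 2,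
      L ≠ 0 ∧ ∀ x, L x = 0 ↔ ∃ u, M.mulVec u = x := by
  have hr : Module.finrank (ZMod 2) (LinearMap.range M.mulVecLin) = k := by
    rw [LinearMap.finrank_range_of_inj (by simpa using! hM)]
    simp
  obtain ⟨L, hL, hle⟩ := Submodule.exists_le_ker_of_lt_top (LinearMap.range M.mulVecLin) <| by
    refine Submodule.lt_top_of_finrank_lt_finrank ?_
    rw [hr]
    simp
  have hk := Module.Dual.finrank_ker_add_one_of_ne_zero hL
  rw [Module.finrank_fin_fun, Nat.add_right_cancel_iff] at hk
  have := Submodule.eq_of_le_of_finrank_eq hle (by rw [hr, hk])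
  refine ⟨L, hL, fun x => ?_⟩
  rw [← LinearMap.mem_ker, ← this, LinearMap.mem_range]
  rfl

lemma degLE_restrict_iff (hM : Function.Injective M.mulVec)
    (hL : ∀ x, L x = 0 ↔ ∃ u, M.mulVec u = x) (f : (Fin (k + 1) → ZMod 2) → ZMod 2)
    (b : Fin (k + 1) → ZMod 2) :
    degLE k d (fun u => f (M.mulVec u + b)) ↔ DegLEOn (k + 1) d L (L b) f := by
  constructor
  · intro h
    obtain ⟨N, hN⟩ := M.mulVecLin.exists_leftInverse_of_injective
      (LinearMap.ker_eq_bot.2 (by simpa using! hM))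
    refine ⟨_, h.comp_affine N (-N b), fun x hx => ?_⟩
    obtain ⟨u, hu⟩ := (hL (x - b)).1 (by rw [map_sub, hx, sub_self])
    have hNu : N x + -N b = u := by
      rw [← sub_eq_add_neg, ← map_sub, ← hu]
      exact LinearMap.congr_fun hN u
    rw [hNu, hu, sub_add_cancel]
  · rintro ⟨g, hg, hfg⟩
    refine (hg.comp_affine M.mulVecLin b).congr fun u => ?_
    rw [Matrix.mulVecLin_apply, hfg]
    rw [map_add, (hL _).2 ⟨u, rfl⟩, zero_add]

lemma exists_injective_mulVec (k : ℕ) :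
    ∃ M : Matrix (Fin (k + 1)) (Fin k) (ZMod 2), Function.Injective M.mulVec := by
  refine ⟨Matrix.submatrix 1 id Fin.castSucc, fun u v h => funext fun i => ?_⟩
  have := congrFun h i.castSucc
  simpa [Matrix.mulVec, dotProduct, Matrix.one_apply] using this

/-- If no linear form divides `f` up to low degree, moving a flat to its parallel translate
injects the accepting flats into the rejecting ones. -/
lemma card_accept_le_of_forall_not_dvdMod {f : (Fin (k + 1) → ZMod 2) → ZMod 2}
    (hf : ∀ L, L ≠ 0 → ¬ DvdMod (k + 1) d L f) :
    (Finset.univ.filter fun Mb : Matrix (Fin (k + 1)) (Fin k) (ZMod 2) × (Fin (k + 1) → ZMod 2) =>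
      Function.Injective Mb.1.mulVec ∧
        degLE k d (fun u => f (Mb.1.mulVec u + Mb.2))).card ≤
    (Finset.univ.filter fun Mb : Matrix (Fin (k + 1)) (Fin k) (ZMod 2) × (Fin (k + 1) → ZMod 2) =>
      Function.Injective Mb.1.mulVec ∧
        ¬ degLE k d (fun u => f (Mb.1.mulVec u + Mb.2))).card := by
  choose! L hL0 hL using
    fun M => @exists_linear_eq_zero_iff_of_injective k M
  choose! v hv using fun L => @exists_apply_eq_one (k + 1) L
  refine Finset.card_le_card_of_injOn (fun Mb => (Mb.1, Mb.2 + v (L Mb.1))) ?_ ?_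
  · rintro ⟨M, b⟩ h
    simp only [Finset.coe_filter, Finset.mem_univ, true_and, Set.mem_ofPred_eq] at h ⊢
    obtain ⟨hM, h⟩ := h
    refine ⟨hM, fun h' => hf _ (hL0 M hM) ?_⟩
    rw [degLE_restrict_iff hM (hL M hM)] at h h'
    rw [map_add, hv _ (hL0 M hM)] at h'
    rcases ZMod.eq_zero_or_eq_one_of_two (L M b) with hb | hb <;> rw [hb] at h h'
    · exact h.dvdMod (by simpa using h')
    · exact DegLEOn.dvdMod (by simpa [CharTwo.add_self_eq_zero] using h') h
  · rintro ⟨M, b⟩ - ⟨M', b'⟩ - h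
    simp only [Prod.mk.injEq] at h ⊢
    obtain ⟨rfl, h⟩ := h
    exact ⟨rfl, add_right_cancel h⟩

/-- If `f` has degree at most `d + 1`, shearing flats so that their defining linear form changes
by a fixed rejecting form `L₀` injects the accepting flats into the rejecting ones. -/
lemma card_accept_le_of_not_dvdMod {f : (Fin (k + 1) → ZMod 2) → ZMod 2}
    (hf : degLE (k + 1) (d + 1) f) {L₀ : (Fin (k + 1) → ZMod 2) →ₗ[ZMod 2] ZMod 2}
    (hL₀ : L₀ ≠ 0) (hfL₀ : ¬ DvdMod (k + 1) d L₀ f) :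
    (Finset.univ.filter fun Mb : Matrix (Fin (k + 1)) (Fin k) (ZMod 2) × (Fin (k + 1) → ZMod 2) =>
      Function.Injective Mb.1.mulVec ∧
        degLE k d (fun u => f (Mb.1.mulVec u + Mb.2))).card ≤
    (Finset.univ.filter fun Mb : Matrix (Fin (k + 1)) (Fin k) (ZMod 2) × (Fin (k + 1) → ZMod 2) =>
      Function.Injective Mb.1.mulVec ∧
        ¬ degLE k d (fun u => f (Mb.1.mulVec u + Mb.2))).card := by
  have accept {M : Matrix (Fin (k + 1)) (Fin k) (ZMod 2)} {b} {L} (hM : Function.Injective M.mulVec)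
      (hL0 : L ≠ 0) (hL : ∀ x, L x = 0 ↔ ∃ u, M.mulVec u = x) :
      degLE k d (fun u => f (M.mulVec u + b)) ↔ DvdMod (k + 1) d L f := by
    rw [degLE_restrict_iff hM hL]
    exact ⟨fun h => h.dvdMod_of_degLE hL0 hf, fun h => h.degLEOn _⟩
  choose! L hL0 hL using
    fun M => @exists_linear_eq_zero_iff_of_injective k M
  choose! v hv hv0 using fun L hL (h : L ≠ L₀) => exists_apply_eq_one_and_eq_zero hL hL₀ h
  let T (L : (Fin (k + 1) → ZMod 2) →ₗ[ZMod 2] ZMod 2) := LinearMap.id + L₀.smulRight (v L)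
  have T_apply (L x) : T L x = x + L₀ x • v L := rfl
  have T_T {L} (h0 : L ≠ 0) (h : L ≠ L₀) (x) : T L (T L x) = x := by
    rw [T_apply, T_apply, map_add, map_smul, hv0 L h0 h, smul_zero, add_zero, add_assoc,
      CharTwo.add_self_eq_zero, add_zero]
  let S (M : Matrix (Fin (k + 1)) (Fin k) (ZMod 2)) := LinearMap.toMatrix' (T (L M) ∘ₗ M.mulVecLin)
  have S_mulVec (M u) : (S M).mulVec u = T (L M) (M.mulVec u) := by
    simp only [S, LinearMap.toMatrix'_mulVec]
    rfl
  have ne {M : Matrix (Fin (k + 1)) (Fin k) (ZMod 2)} {b} (hM : Function.Injective M.mulVec)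
      (h : degLE k d (fun u => f (M.mulVec u + b))) : L M ≠ L₀ := by
    rw [accept hM (hL0 M hM) (hL M hM)] at h
    rintro rfl
    exact hfL₀ h
  have S_inj {M : Matrix (Fin (k + 1)) (Fin k) (ZMod 2)} (hM : Function.Injective M.mulVec)
      (hne : L M ≠ L₀) : Function.Injective (S M).mulVec := by
    intro u u' h
    rw [S_mulVec, S_mulVec] at h
    have := congrArg (T (L M)) h
    rw [T_T (hL0 M hM) hne, T_T (hL0 M hM) hne] at this
    exact hM this
  have S_ker {M : Matrix (Fin (k + 1)) (Fin k) (ZMod 2)} (hM : Function.Injective M.mulVec)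
      (hne : L M ≠ L₀) (x) : (L M + L₀) x = 0 ↔ ∃ u, (S M).mulVec u = x := by
    have : (L M + L₀) x = L M (T (L M) x) := by
      rw [T_apply, map_add, map_smul, hv _ (hL0 M hM) hne]
      simp
    rw [this, hL M hM]
    simp only [S_mulVec]
    refine exists_congr fun u => ⟨fun h => ?_, fun h => ?_⟩
    · rw [h, T_T (hL0 M hM) hne]
    · rw [← h, T_T (hL0 M hM) hne]
  refine Finset.card_le_card_of_injOn (fun Mb => (S Mb.1, Mb.2)) ?_ ?_
  · rintro ⟨M, b⟩ h
    simp only [Finset.coe_filter, Finset.mem_univ, true_and, Set.mem_ofPred_eq] at h ⊢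
    obtain ⟨hM, h⟩ := h
    have hne := ne hM h
    rw [accept hM (hL0 M hM) (hL M hM)] at h
    have add_ne : L M + L₀ ≠ 0 := fun h0 => hne <| LinearMap.ext fun x =>
      CharTwo.add_eq_zero.1 (LinearMap.congr_fun h0 x)
    refine ⟨S_inj hM hne, fun h' => hfL₀ ?_⟩
    rw [accept (S_inj hM hne) add_ne (S_ker hM hne)] at h'
    have key : L M + (L M + L₀) = L₀ := LinearMap.ext fun x => by
      simp [← add_assoc, CharTwo.add_self_eq_zero]
    rw [← key]
    exact h.add_s10 h' (hL0 M hM) add_ne fun h => hL₀ (by simpa using h)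
  · rintro ⟨M, b⟩ h ⟨M', b'⟩ h' heq
    simp only [Finset.coe_filter, Finset.mem_univ, true_and, Set.mem_ofPred_eq] at h h'
    simp only [Prod.mk.injEq] at heq ⊢
    have hne := ne h.1 h.2
    have hne' := ne h'.1 h'.2
    have hLL : L M = L M' := by
      refine add_right_cancel (b := L₀) (eq_of_forall_apply_eq_zero_iff fun x => ?_)
      rw [S_ker h.1 hne, S_ker h'.1 hne', heq.1]
    refine ⟨Matrix.ext_of_mulVec_single fun i => ?_, heq.2⟩
    have h1 := S_mulVec M (Pi.single i 1)
    rw [heq.1, S_mulVec, ← hLL] at h1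
    have := congrArg (T (L M)) h1
    rw [T_T (hL0 M h.1) hne, T_T (hL0 M h.1) hne] at this
    exact this.symm

end Flats

theorem statement10 (d k : ℕ) (hk : d + 1 ≤ k)
    (f : (Fin (k+1) → ZMod 2) → ZMod 2) (hf : ¬ degLE (k+1) d f) :
    (1/2 : ℝ) ≤ Rej (k+1) d k f := by
  have hle : (Finset.univ.filter fun Mb :
        Matrix (Fin (k + 1)) (Fin k) (ZMod 2) × (Fin (k + 1) → ZMod 2) =>
      Function.Injective Mb.1.mulVec ∧
        degLE k d (fun u => f (Mb.1.mulVec u + Mb.2))).card ≤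
    (Finset.univ.filter fun Mb : Matrix (Fin (k + 1)) (Fin k) (ZMod 2) × (Fin (k + 1) → ZMod 2) =>
      Function.Injective Mb.1.mulVec ∧
        ¬ degLE k d (fun u => f (Mb.1.mulVec u + Mb.2))).card := by
    by_cases h : ∃ L, L ≠ 0 ∧ DvdMod (k + 1) d L f
    · obtain ⟨L, -, hL⟩ := h
      obtain ⟨i, hi⟩ : ∃ i, ¬ DvdMod (k + 1) d (LinearMap.proj i) f := by
        by_contra! hi
        exact hf (degLE_of_dvdMod_proj Finset.univ (by simpa using hk) fun i _ => hi i)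
      refine card_accept_le_of_not_dvdMod hL.degLE (fun h0 => ?_) hi
      simpa using LinearMap.congr_fun h0 (Pi.single i 1)
    · exact card_accept_le_of_forall_not_dvdMod fun L hL hd => h ⟨L, hL, hd⟩
  have hpos : 0 < (Finset.univ.filter fun Mb :
      Matrix (Fin (k + 1)) (Fin k) (ZMod 2) × (Fin (k + 1) → ZMod 2) =>
        Function.Injective Mb.1.mulVec).card := by
    obtain ⟨M, hM⟩ := exists_injective_mulVec k
    exact Finset.card_pos.2 ⟨(M, 0), by simpa using hM⟩
  have hsum := Finset.card_filter_add_card_filter_not (s := Finset.univ.filter fun Mb :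
      Matrix (Fin (k + 1)) (Fin k) (ZMod 2) × (Fin (k + 1) → ZMod 2) =>
        Function.Injective Mb.1.mulVec)
    (fun Mb => degLE k d (fun u => f (Mb.1.mulVec u + Mb.2)))
  rw [Finset.filter_filter, Finset.filter_filter] at hsum
  rw [Rej, div_le_div_iff₀ two_pos (by exact_mod_cast hpos), one_mul]
  norm_cast
  lia


end
end

section
/- For every n ≥ d+1 and every f : F₂ⁿ → F₂, one has Rej⁰_d(f) ≥ (1/4) · Rej_{d,d+1}(f). -/
open scoped Classical

noncomputable section

/-- A function on `𝔽₂^(d+1)` whose values sum to zero has degree at most `d`. -/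
theorem degLE_of_sum_eq_zero (d : ℕ) (g : (Fin (d + 1) → ZMod 2) → ZMod 2)
    (hg : ∑ v, g v = 0) : degLE (d + 1) d g := by
  have hexp : ∀ c : Fin (d + 1) → ZMod 2,
      (∏ i, (MvPolynomial.X i + MvPolynomial.C (c i)) - ∏ i, MvPolynomial.X i :
        MvPolynomial (Fin (d + 1)) (ZMod 2)).totalDegree ≤ d := by
    intro c
    rw [Finset.prod_add, ← Finset.sum_erase_add _ _ (Finset.mem_powerset_self Finset.univ)]
    simp only [Finset.sdiff_self, Finset.prod_empty, mul_one, add_sub_cancel_right]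
    refine MvPolynomial.totalDegree_finsetSum_le fun t ht => ?_
    rw [← map_prod, mul_comm, ← MvPolynomial.smul_eq_C_mul]
    refine (MvPolynomial.totalDegree_smul_le _ _).trans
      ((MvPolynomial.totalDegree_finsetProd _ _).trans ?_)
    have hlt : t.card < d + 1 := by
      simpa using Finset.card_lt_univ_of_notMem
        (Classical.not_forall.mp (fun h => (Finset.mem_erase.mp ht).1
          (Finset.eq_univ_iff_forall.mpr h))).choose_spec
    simpa [MvPolynomial.totalDegree_X] using Nat.lt_succ_iff.mp hlt
  refine ⟨∑ v, g v • (∏ i, (MvPolynomial.X i + MvPolynomial.C (1 + v i)) -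
    ∏ i, MvPolynomial.X i), ?_, fun x => ?_⟩
  · exact MvPolynomial.totalDegree_finsetSum_le fun v _ =>
      (MvPolynomial.totalDegree_smul_le _ _).trans (hexp _)
  · have hdelta : ∀ v : Fin (d + 1) → ZMod 2,
        ∏ i, (x i + (1 + v i)) = if v = x then 1 else 0 := by
      intro v
      split_ifs with hv
      · subst hv
        refine Finset.prod_eq_one fun i _ => ?_
        generalize v i = a
        revert a
        decide
      · obtain ⟨i, hi⟩ := Function.ne_iff.mp hv
        refine Finset.prod_eq_zero (Finset.mem_univ i) ?_
        revert hi
        generalize v i = a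
        generalize x i = b
        revert a b
        decide
    simp [MvPolynomial.smul_eval, mul_sub, Finset.sum_sub_distrib, ← Finset.sum_mul, hg, hdelta]

/-- Summing over subsets of the directions agrees with summing over the parametrized cube. -/
theorem sum_finset_eq_sum_mulVec {n k : ℕ} (f : (Fin n → ZMod 2) → ZMod 2)
    (M : Matrix (Fin n) (Fin k) (ZMod 2)) (b : Fin n → ZMod 2) :
    ∑ S : Finset (Fin k), f (b + ∑ i ∈ S, M.col i) = ∑ u, f (M.mulVec u + b) := by
  refine Finset.sum_bij' (fun S _ i => if i ∈ S then 1 else 0)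
    (fun u _ => Finset.univ.filter fun i => u i = 1) (by simp) (by simp) (by simp) ?_ ?_
  · intro u _
    ext i
    simp only [Finset.mem_filter_univ]
    generalize u i = a
    revert a
    decide
  · intro S _
    congr 1
    rw [add_comm]
    congr 1
    ext j
    simp [Matrix.mulVec, dotProduct]

theorem card_injective_mulVec (n k : ℕ) (h : k ≤ n) :
    ((Finset.univ.filter fun Mb : Matrix (Fin n) (Fin k) (ZMod 2) × (Fin n → ZMod 2) =>
      Function.Injective Mb.1.mulVec).card : ℝ) =
      2 ^ n * ∏ i ∈ Finset.range k, ((2 : ℝ) ^ n - 2 ^ i) := by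
  have hlin := card_linearIndependent (K := ZMod 2) (V := Fin n → ZMod 2) (k := k) (by simpa)
  have hcard : (Finset.univ.filter fun M : Matrix (Fin n) (Fin k) (ZMod 2) =>
      Function.Injective M.mulVec).card = ∏ i : Fin k, (2 ^ n - 2 ^ (i : ℕ)) := by
    simp only [Module.finrank_fin_fun, ZMod.card] at hlin
    rw [← hlin, Nat.card_eq_fintype_card, Fintype.card_subtype]
    refine Finset.card_bij (fun M _ => M.col) ?_ ?_ ?_
    · simp [Matrix.mulVec_injective_iff]
    · intro M _ M' _ hM
      ext i j
      exact congrFun (congrFun hM j) i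
    · intro a ha
      refine ⟨Matrix.of fun i j => a j i, ?_, rfl⟩
      simp only [Finset.mem_filter_univ, Matrix.mulVec_injective_iff] at ha ⊢
      exact ha
  have hprod : (Finset.univ.filter fun Mb : Matrix (Fin n) (Fin k) (ZMod 2) × (Fin n → ZMod 2) =>
      Function.Injective Mb.1.mulVec) =
      (Finset.univ.filter fun M : Matrix (Fin n) (Fin k) (ZMod 2) =>
        Function.Injective M.mulVec) ×ˢ Finset.univ := by
    ext; simp
  rw [hprod, Finset.card_product, hcard, mul_comm, Finset.prod_range]
  push_cast
  congr 1
  · simp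
  · refine Finset.prod_congr rfl fun i _ => ?_
    rw [Nat.cast_sub (Nat.pow_le_pow_right (by norm_num) (i.2.le.trans h))]
    simp

theorem one_sub_mul_pow_le_prod (n k : ℕ) (h : k ≤ n) :
    (1 - (2 : ℝ) ^ k / 2 ^ n) * (2 ^ n) ^ k ≤ ∏ i ∈ Finset.range k, ((2 : ℝ) ^ n - 2 ^ i) := by
  induction k with
  | zero => simp
  | succ k ih =>
    rw [Finset.prod_range_succ]
    have hk : (2 : ℝ) ^ k ≤ 2 ^ n := pow_le_pow_right₀ (by norm_num) (by omega)
    have hn : (0 : ℝ) < 2 ^ n := by positivity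
    refine le_trans ?_ (mul_le_mul_of_nonneg_right (ih (by omega)) (sub_nonneg.mpr hk))
    have hsq : (1 - (2 : ℝ) ^ k / 2 ^ n) * (2 ^ n) ^ k * (2 ^ n - 2 ^ k) =
        (1 - (2 : ℝ) ^ k / 2 ^ n) ^ 2 * (2 ^ n) ^ (k + 1) := by
      field_simp
      ring
    rw [hsq]
    refine mul_le_mul_of_nonneg_right ?_ (by positivity)
    rw [pow_succ, mul_div_right_comm]
    nlinarith [sq_nonneg ((2 : ℝ) ^ k / 2 ^ n)]

theorem quarter_mul_pow_le_prod (n d : ℕ) (h : d + 1 ≤ n) :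
    (1 / 4 : ℝ) * (2 ^ n) ^ (d + 1) ≤ ∏ i ∈ Finset.range (d + 1), ((2 : ℝ) ^ n - 2 ^ i) := by
  rw [Finset.prod_range_succ]
  have hn : (0 : ℝ) < 2 ^ n := by positivity
  have hd : 2 * (2 : ℝ) ^ d ≤ 2 ^ n := by
    rw [← pow_succ']
    exact pow_le_pow_right₀ (by norm_num) h
  have hhalf : (1 / 2 : ℝ) ≤ 1 - 2 ^ d / 2 ^ n := by
    rw [le_sub_comm, div_le_iff₀ hn]
    linarith
  calc (1 / 4 : ℝ) * (2 ^ n) ^ (d + 1) = (1 / 2 * (2 ^ n) ^ d) * (1 / 2 * 2 ^ n) := by ring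
    _ ≤ _ := by
      refine mul_le_mul (le_trans ?_ (one_sub_mul_pow_le_prod n d (by omega))) (by linarith)
        (by positivity) (Finset.prod_nonneg fun i hi => ?_)
      · gcongr
      · have := Finset.mem_range.mp hi
        exact sub_nonneg.mpr (pow_le_pow_right₀ (by norm_num) (by omega))

/-- Every rejecting flat parametrization gives a rejecting choice of base point and directions. -/
theorem card_rejecting_le (n d : ℕ) (f : (Fin n → ZMod 2) → ZMod 2) :
    (Finset.univ.filter fun Mb : Matrix (Fin n) (Fin (d + 1)) (ZMod 2) × (Fin n → ZMod 2) =>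
      Function.Injective Mb.1.mulVec ∧
        ¬ degLE (d + 1) d (fun u => f (Mb.1.mulVec u + Mb.2))).card ≤
    (Finset.univ.filter fun xa : (Fin n → ZMod 2) × (Fin (d + 1) → Fin n → ZMod 2) =>
      (∑ S : Finset (Fin (d + 1)), f (xa.1 + ∑ i ∈ S, xa.2 i)) = 1).card := by
  refine Finset.card_le_card_of_injOn (fun Mb => (Mb.2, Mb.1.col)) ?_ ?_
  · rintro ⟨M, b⟩ hM
    simp only [Finset.coe_filter, Finset.mem_univ, true_and, Set.mem_ofPred_eq] at hM ⊢
    rw [sum_finset_eq_sum_mulVec]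
    have hne := mt (degLE_of_sum_eq_zero d _) hM.2
    revert hne
    generalize ∑ u, f (M.mulVec u + b) = a
    revert a
    decide
  · rintro ⟨M, b⟩ _ ⟨M', b'⟩ _ hM
    obtain ⟨hb, hM⟩ := Prod.mk.inj hM
    refine Prod.ext ?_ hb
    ext i j
    exact congrFun (congrFun hM j) i

theorem statement12 (n d : ℕ) (h : d + 1 ≤ n) (f : (Fin n → ZMod 2) → ZMod 2) :
    (1/4 : ℝ) * Rej n d (d+1) f ≤ Rej0 n d f := by
  unfold Rej Rej0
  rw [card_injective_mulVec n (d + 1) h]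
  have hB := (Nat.cast_le (α := ℝ)).mpr (card_rejecting_le n d f)
  have hP := mul_le_mul_of_nonneg_left (quarter_mul_pow_le_prod n d h)
    (by positivity : (0 : ℝ) ≤ 2 ^ n)
  have hT : (0 : ℝ) < 2 ^ n * (2 ^ n) ^ (d + 1) := by positivity
  have hN : (1 / 4 : ℝ) * (2 ^ n * (2 ^ n) ^ (d + 1)) ≤
      2 ^ n * ∏ i ∈ Finset.range (d + 1), ((2 : ℝ) ^ n - 2 ^ i) := by linarith
  calc _ ≤ (1 / 4 : ℝ) * (_ / (1 / 4 * (2 ^ n * (2 ^ n) ^ (d + 1)))) :=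
        mul_le_mul_of_nonneg_left
          (div_le_div₀ (Nat.cast_nonneg _) hB (by positivity) hN) (by norm_num)
    _ = _ := by field_simp

end
end
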